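/- The group B_{4,2} is presented by the generators x, y and the relations x⁴ = y³, [x², yxy] = 1, and x_i⁴ = 1, [x_i², yxy] = 1 for every integer i ≥ 1. Precisely, the homomorphism from the free group on two generators x, y onto B_{4,2} sending x ↦ X and y ↦ Y is surjective and its kernel equals the normal closure of the set of relators {x⁴y⁻³, [x², yxy]} ∪ {x_i⁴ : i ≥ 1} ∪ {[x_i², yxy] : i ≥ 1}. -/

import Mathlib

/-!
Common setup: the commutator convention `[a,b] = a⁻¹b⁻¹ab` of the paper, the sequence
`x₀ = x`, `x_{i+1} = [yxy, x_i]`, the Laurent polynomial ring `R = 𝔽₂[t,t⁻¹]`, and the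
images `X`, `Y` of `σ₁σ₂σ₃` and `σ₁σ₂σ₃σ₁` in `GL(3, R)` under the mod-2 reduced Burau
representation of the 4-strand braid group.
-/

open Matrix LaurentPolynomial

noncomputable section

set_option maxRecDepth 100000

/-- The paper's commutator convention: `[a,b] = a⁻¹b⁻¹ab`. -/
def br {G : Type*} [Group G] (a b : G) : G := a⁻¹ * b⁻¹ * a * b

/-- The recursively defined elements `x₀ = x`, `x_{i+1} = [yxy, x_i]`. -/
def xseq {G : Type*} [Group G] (x y : G) : ℕ → G
  | 0 => x
  | n + 1 => br (y * x * y) (xseq x y n)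

/-- `R = 𝔽₂[t,t⁻¹]`, the ring of Laurent polynomials over the field with two elements. -/
abbrev R2 : Type := LaurentPolynomial (ZMod 2)

instance : CharP R2 2 := charP_of_injective_algebraMap (algebraMap (ZMod 2) R2).injective 2

/-- The matrix `X = t·!![0,0,1; 1,0,1; 0,1,1]`. -/
def Xmat : Matrix (Fin 3) (Fin 3) R2 := (T 1 : R2) • !![0,0,1; 1,0,1; 0,1,1]

/-- The matrix `Y = t·!![0,0,1; t,1,1; 0,1,1]`. -/
def Ymat : Matrix (Fin 3) (Fin 3) R2 := (T 1 : R2) • !![0,0,1; T 1,1,1; 0,1,1]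

/-- An explicit inverse for `Xmat`. -/
def Xmatinv : Matrix (Fin 3) (Fin 3) R2 := (T (-1) : R2) • !![1,1,0; 1,0,1; 1,0,0]

/-- An explicit inverse for `Ymat`. -/
def Ymatinv : Matrix (Fin 3) (Fin 3) R2 := (T (-2) : R2) • !![0,1,1; T 1,0,T 1; T 1,0,0]

lemma Xmat_mul_Xmatinv : Xmat * Xmatinv = 1 := by
  rw [Xmat, Xmatinv, Matrix.smul_mul, Matrix.mul_smul, smul_smul, ← T_add]
  simp only [Matrix.mul_fin_three, mul_zero, zero_mul, mul_one, one_mul, add_zero, zero_add,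
    ← T_add, CharTwo.add_self_eq_zero]
  rw [Matrix.one_fin_three]
  simp only [Matrix.smul_of, Matrix.smul_cons, smul_eq_mul, Matrix.smul_empty, ← T_add,
    mul_zero, mul_one]
  norm_num [T_zero]

lemma Xmatinv_mul_Xmat : Xmatinv * Xmat = 1 := by
  rw [Xmat, Xmatinv, Matrix.smul_mul, Matrix.mul_smul, smul_smul, ← T_add]
  simp only [Matrix.mul_fin_three, mul_zero, zero_mul, mul_one, one_mul, add_zero, zero_add,
    ← T_add, CharTwo.add_self_eq_zero]
  rw [Matrix.one_fin_three]
  simp only [Matrix.smul_of, Matrix.smul_cons, smul_eq_mul, Matrix.smul_empty, ← T_add,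
    mul_zero, mul_one]
  norm_num [T_zero]

lemma Ymat_mul_Ymatinv : Ymat * Ymatinv = 1 := by
  rw [Ymat, Ymatinv, Matrix.smul_mul, Matrix.mul_smul, smul_smul, ← T_add]
  simp only [Matrix.mul_fin_three, mul_zero, zero_mul, mul_one, one_mul, add_zero, zero_add,
    ← T_add, CharTwo.add_self_eq_zero]
  rw [Matrix.one_fin_three]
  simp only [Matrix.smul_of, Matrix.smul_cons, smul_eq_mul, Matrix.smul_empty, ← T_add,
    mul_zero, mul_one]
  norm_num [T_zero]

lemma Ymatinv_mul_Ymat : Ymatinv * Ymat = 1 := by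
  rw [Ymat, Ymatinv, Matrix.mul_smul, Matrix.smul_mul, smul_smul, ← T_add]
  simp only [Matrix.mul_fin_three, mul_zero, zero_mul, mul_one, one_mul, add_zero, zero_add,
    ← T_add, CharTwo.add_self_eq_zero]
  rw [Matrix.one_fin_three]
  simp only [Matrix.smul_of, Matrix.smul_cons, smul_eq_mul, Matrix.smul_empty, ← T_add,
    mul_zero, mul_one]
  norm_num [T_zero]

/-- `X ∈ GL(3, 𝔽₂[t,t⁻¹])`, the mod-2 reduced Burau image of `σ₁σ₂σ₃`. -/
def X : GL (Fin 3) R2 := ⟨Xmat, Xmatinv, Xmat_mul_Xmatinv, Xmatinv_mul_Xmat⟩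

/-- `Y ∈ GL(3, 𝔽₂[t,t⁻¹])`, the mod-2 reduced Burau image of `σ₁σ₂σ₃σ₁`. -/
def Y : GL (Fin 3) R2 := ⟨Ymat, Ymatinv, Ymat_mul_Ymatinv, Ymatinv_mul_Ymat⟩

/-- `B_{4,2}`, the subgroup of `GL(3,R)` generated by `X` and `Y`. -/
abbrev B42 : Subgroup (GL (Fin 3) R2) := Subgroup.closure {X, Y}

/-- The relators `{x⁴y⁻³, [x², yxy]} ∪ {x_i⁴ : i ≥ 1} ∪ {[x_i², yxy] : i ≥ 1}` in the
free group on two generators `x, y`. -/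
def b42Rels : Set (FreeGroup (Fin 2)) :=
  {(FreeGroup.of 0) ^ 4 * ((FreeGroup.of 1) ^ 3)⁻¹,
      br ((FreeGroup.of 0) ^ 2) (FreeGroup.of 1 * FreeGroup.of 0 * FreeGroup.of 1)} ∪
    {r | ∃ i : ℕ, 1 ≤ i ∧ r = xseq (FreeGroup.of 0) (FreeGroup.of 1) i ^ 4} ∪
    {r | ∃ i : ℕ, 1 ≤ i ∧ r = br (xseq (FreeGroup.of 0) (FreeGroup.of 1) i ^ 2)
      (FreeGroup.of 1 * FreeGroup.of 0 * FreeGroup.of 1)}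

set_option linter.all false

/-- involution -/
abbrev bar (f : R2) : R2 := LaurentPolynomial.invert f

/-- order at least k -/
def ge (k : ℤ) (f : R2) : Prop := ∀ i < k, f.coeff i = 0

lemma zmod2_ne {a : ZMod 2} (h : a ≠ 0) : a = 1 := by
  revert a; decide

lemma eq_sum_T (f : R2) : f = ∑ i ∈ f.coeff.support, T i := by
  ext j
  rw [AddMonoidAlgebra.coeff_sum, Finsupp.finsetSum_apply]
  simp only [T_apply]
  rw [Finset.sum_ite_eq']
  split_ifs with h
  · exact zmod2_ne (by simpa using h)
  · simpa using h

lemma ge_zero (k : ℤ) : ge k 0 := fun _ _ => rfl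

lemma ge_add {k : ℤ} {f g : R2} (hf : ge k f) (hg : ge k g) : ge k (f + g) := by
  intro i hi
  rw [AddMonoidAlgebra.coeff_add, Finsupp.add_apply, hf i hi, hg i hi, add_zero]

lemma ge_mono {k l : ℤ} {f : R2} (h : l ≤ k) (hf : ge k f) : ge l f :=
  fun i hi => hf i (lt_of_lt_of_le hi h)

lemma coeff_T_mul (n : ℤ) (f : R2) (i : ℤ) : (T n * f).coeff i = f.coeff (i - n) := by
  have h := AddMonoidAlgebra.coeff_single_mul_apply f (1 : ZMod 2) n i
  rw [one_mul] at h
  rw [show i - n = -n + i by ring]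
  exact h

lemma ge_T_mul {k n : ℤ} {f : R2} : ge k (T n * f) ↔ ge (k - n) f := by
  constructor
  · intro h i hi
    have := h (i + n) (by omega)
    rwa [coeff_T_mul, add_sub_cancel_right] at this
  · intro h i hi
    rw [coeff_T_mul]
    exact h _ (by omega)

lemma ge_T {k n : ℤ} (h : k ≤ n) : ge k (T n) := by
  intro i hi
  rw [T_apply, if_neg (by omega)]

lemma ge_one : ge 0 (1 : R2) := by
  rw [← T_zero]; exact ge_T le_rfl

lemma ge_ind {k : ℤ} {S : AddSubgroup R2} (hS : ∀ n ≥ k, T n ∈ S) {f : R2} (hf : ge k f) : f ∈ S := by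
  rw [eq_sum_T f]
  refine sum_mem fun i hi => hS i ?_
  by_contra h
  exact (by simpa using hi : f.coeff i ≠ 0) (hf i (by omega))

lemma ge_mul {k l : ℤ} {f g : R2} (hf : ge k f) (hg : ge l g) : ge (k + l) (f * g) := by
  let S : AddSubgroup R2 :=
    { carrier := {f | ge (k + l) (f * g)}
      zero_mem' := by simpa using ge_zero _
      add_mem' := fun {a b} ha hb => by
        show ge _ _
        rw [add_mul]; exact ge_add ha hb
      neg_mem' := fun {a} ha => by
        show ge _ _
        rw [CharTwo.neg_eq]; exact ha }
  refine ge_ind (S := S) (fun n hn => ?_) hf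
  show ge _ _
  rw [ge_T_mul]
  exact ge_mono (by omega) hg

lemma ge_mul0 {l : ℤ} {f g : R2} (hf : ge 0 f) (hg : ge l g) : ge l (f * g) := by
  simpa using ge_mul hf hg

lemma exists_ge (f : R2) : ∃ N : ℕ, ge (-(N : ℤ)) f := by
  refine ⟨∑ i ∈ f.coeff.support, i.natAbs, fun i hi => ?_⟩
  by_contra h
  have : i.natAbs ≤ ∑ i ∈ f.coeff.support, i.natAbs :=
    Finset.single_le_sum (f := fun i : ℤ => i.natAbs) (fun _ _ => Nat.zero_le _) (by simpa using h)
  omega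

lemma coeff_sum_T (s : Finset ℤ) (j : ℤ) : (∑ i ∈ s, T i : R2).coeff j = if j ∈ s then 1 else 0 := by
  rw [AddMonoidAlgebra.coeff_sum, Finsupp.finsetSum_apply]
  simp only [T_apply]
  rw [Finset.sum_ite_eq']

lemma exists_trunc (f : R2) : ∃ g h : R2, f = g + h ∧ ge 0 h ∧ ge 1 (bar g) := by
  refine ⟨∑ i ∈ f.coeff.support.filter (· < 0), T i, ∑ i ∈ f.coeff.support.filter (¬ · < 0), T i, ?_, ?_, ?_⟩
  · conv_lhs => rw [eq_sum_T f]
    rw [Finset.sum_filter_add_sum_filter_not]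
  · intro i hi
    rw [coeff_sum_T, if_neg]
    simp; intro _; omega
  · intro i hi
    rw [invert_apply, coeff_sum_T, if_neg]
    simp; intro _; omega

lemma exists_lead {f : R2} (hf : f ≠ 0) : ∃ c, ge c f ∧ f.coeff c ≠ 0 := by
  have hne : f.coeff.support.Nonempty := by
    rw [Finsupp.support_nonempty_iff]
    simpa using hf
  refine ⟨f.coeff.support.min' hne, fun i hi => ?_, by simpa using Finset.min'_mem _ hne⟩
  by_contra h
  have := Finset.min'_le f.coeff.support i (by simpa using h)
  omega

lemma approx {I : AddSubgroup R2} (ht : ∀ f ∈ I, T 1 * f ∈ I) {N : ℤ} (hN : ∀ n ≥ N, T n ∈ I)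
    {f : R2} {c : ℤ} (hf : f ∈ I) (hc : ge c f) (hl : f.coeff c ≠ 0) : ∀ n ≥ c, T n ∈ I := by
  have htn : ∀ (k : ℕ), ∀ f ∈ I, T (k : ℤ) * f ∈ I := by
    intro k
    induction k with
    | zero => intro f hf; simpa [T_zero] using hf
    | succ k ih =>
      intro f hf
      have := ht _ (ih f hf)
      rwa [← mul_assoc, ← T_add, add_comm] at this
  have key : ∀ d : ℕ, ∀ n ≥ N - d, n ≥ c → T n ∈ I := by
    intro d
    induction d with
    | zero => intro n hn _; exact hN n (by simpa using hn)
    | succ d ih =>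
      intro n hn hnc
      by_cases h : n ≥ N - d
      · exact ih n h hnc
      have h1 : T (n - c) * f ∈ I := by
        have := htn (n - c).toNat f hf
        rwa [Int.toNat_of_nonneg (by omega)] at this
      have h2 : T (n - c) * f + T n ∈ I := by
        refine ge_ind (k := n + 1) (fun m hm => ih m (by push_cast at hn; omega) (by omega)) ?_
        intro i hi
        rw [AddMonoidAlgebra.coeff_add, Finsupp.add_apply, coeff_T_mul, T_apply]
        by_cases hin : i = n
        · subst hin
          rw [if_pos rfl, show i - (i - c) = c by ring, zmod2_ne hl]; decide
        · rw [if_neg (by omega), hc _ (by omega), add_zero]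
      exact (I.add_mem_cancel_left h1).1 h2
  intro n hn
  exact key (N - n).toNat n (by omega) hn

lemma bar_bar (f : R2) : bar (bar f) = f := involutive_invert f

lemma ge_bar_contra {f : R2} {k l : ℤ} (hf : ge k f) (hb : ge l (bar f)) (h : 0 < k + l) : f = 0 := by
  ext i
  by_cases hi : i < k
  · exact hf i hi
  · have := hb (-i) (by omega)
    rwa [invert_apply, neg_neg] at this

/-- sequence with z -/
def zseq {H : Type*} [Group H] (x z : H) : ℕ → H
  | 0 => x
  | n + 1 => br z (zseq x z n)

lemma map_zseq {H K : Type*} [Group H] [Group K] (f : H →* K) (x z : H) (n : ℕ) :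
    f (zseq x z n) = zseq (f x) (f z) n := by
  induction n with
  | zero => rfl
  | succ n ih => simp [zseq, br, ih]

/-- conjugates -/
def cj {H : Type*} [Group H] (x z : H) (k : ℤ) : H := z ^ (-k) * x * z ^ k

lemma map_cj {H K : Type*} [Group H] [Group K] (f : H →* K) (x z : H) (n : ℤ) :
    f (cj x z n) = cj (f x) (f z) n := by
  simp [cj]

section
variable {H : Type*} [Group H] {x z : H}

lemma cj_zero : cj x z 0 = x := by simp [cj]

lemma cj_conj (k l : ℤ) : z ^ (-l) * cj x z k * z ^ l = cj x z (k + l) := by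
  simp only [cj, neg_add, _root_.zpow_add]
  group

lemma cj_conj1 (k : ℤ) : z⁻¹ * cj x z k * z = cj x z (k + 1) := by
  simpa using cj_conj (x := x) (z := z) k 1

lemma cj_sq (h : x * x = 1) (k : ℤ) : cj x z k * cj x z k = 1 := by
  have : cj x z k * cj x z k = z ^ (-k) * (x * x) * z ^ k := by
    simp only [cj]; group
  rw [this, h]; group

lemma comm_shift {k l : ℤ} (m : ℤ) (h : Commute (cj x z k) (cj x z l)) :
    Commute (cj x z (k + m)) (cj x z (l + m)) := by
  rw [← cj_conj k m, ← cj_conj l m]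
  have e : ∀ g : H, z ^ (-m) * g * z ^ m = MulAut.conj (z ^ (-m)) g := by
    intro g; rw [MulAut.conj_apply, _root_.zpow_neg, inv_inv]
  rw [e, e]
  exact h.map (MulAut.conj (z ^ (-m)) : H →* H)

lemma seq_form (hx : x * x = 1) (n : ℕ) (hC : ∀ j : ℕ, j ≤ n → Commute (cj x z j) (cj x z 0)) :
    ∃ m, zseq x z (n + 1) = cj x z (n + 1) * m * cj x z 0 ∧ m * m = 1 ∧ Commute m (cj x z 0) ∧
      Commute m (cj x z (n + 1)) := by
  set S : ℕ → Subgroup H := fun n => Subgroup.closure {g | ∃ i : ℤ, 1 ≤ i ∧ i ≤ n ∧ g = cj x z i} with hS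
  have hCC : ∀ i j : ℤ, i - j ≤ n → j - i ≤ n → Commute (cj x z i) (cj x z j) := by
    have h1 : ∀ i j : ℤ, i - j ≤ n → j ≤ i → Commute (cj x z i) (cj x z j) := by
      intro i j h1 h2
      have := comm_shift j (hC (i - j).toNat (by omega))
      rw [Int.toNat_of_nonneg (by omega)] at this
      simpa using this
    intro i j h1' h2'
    rcases le_total j i with h | h
    · exact h1 i j h1' h
    · exact (h1 j i h2' h).symm
  have hcl : ∀ (k : ℕ) (g : H), (∀ i : ℤ, 1 ≤ i → i ≤ k → Commute (cj x z i) g) → ∀ m ∈ S k, Commute m g := by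
    intro k g hg m hm
    have : S k ≤ Subgroup.centralizer {g} := by
      rw [hS, Subgroup.closure_le]
      rintro _ ⟨i, h1, h2, rfl⟩
      rw [SetLike.mem_coe, Subgroup.mem_centralizer_singleton_iff]
      exact (hg i h1 h2).eq
    exact (Subgroup.mem_centralizer_singleton_iff.1 (this hm))
  have hinv : ∀ i, (cj x z i)⁻¹ = cj x z i := fun i => inv_eq_of_mul_eq_one_left (cj_sq hx i)
  have hmono : ∀ k l, k ≤ l → S k ≤ S l := by
    intro k l hkl
    apply Subgroup.closure_mono
    rintro _ ⟨i, h1, h2, rfl⟩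
    exact ⟨i, h1, by omega, rfl⟩
  have form : ∀ k ≤ n, ∃ m ∈ S k, zseq x z (k + 1) = cj x z (k + 1) * m * cj x z 0 := by
    intro k
    induction k with
    | zero =>
      intro _
      refine ⟨1, one_mem _, ?_⟩
      have := hinv 1
      simp only [zseq, br]
      simp only [Nat.cast_zero, zero_add, cj_zero]
      rw [← this]; simp only [cj]; group
    | succ k ih =>
      intro hk
      obtain ⟨m, hm, e⟩ := ih (by omega)
      have hsm : z⁻¹ * m * z ∈ S (k + 1) := by
        have hle : S k ≤ (S (k+1)).comap (MulAut.conj z⁻¹ : H →* H) := by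
          rw [hS, Subgroup.closure_le]
          rintro _ ⟨i, h1, h2, rfl⟩
          refine Subgroup.subset_closure ⟨i + 1, by omega, by push_cast; omega, ?_⟩
          rw [← cj_conj1]; simp
        have := hle hm
        simpa using this
      have h1 : cj x z 1 ∈ S (k+1) := Subgroup.subset_closure ⟨1, by omega, by push_cast; omega, rfl⟩
      have h2 : cj x z (k+1) ∈ S (k+1) := Subgroup.subset_closure ⟨k+1, by omega, by push_cast; omega, rfl⟩
      have hm' := hmono k (k+1) (by omega) hm
      have hA : Commute (cj x z 1 * (z⁻¹ * m * z)⁻¹) (cj x z (k + 1 + 1)) := by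
        refine hcl (k+1) _ ?_ _ (mul_mem h1 (inv_mem hsm))
        intro i h1 h2
        push_cast at h2
        apply hCC <;> omega
      refine ⟨cj x z 1 * (z⁻¹ * m * z)⁻¹ * cj x z (k+1) * m,
        mul_mem (mul_mem (mul_mem h1 (inv_mem hsm)) h2) hm', ?_⟩
      have e2 : zseq x z (k + 1 + 1) = (z⁻¹ * zseq x z (k+1) * z)⁻¹ * zseq x z (k + 1) := by
        simp only [zseq, br]; group
      rw [e2, e]
      have e3 : z⁻¹ * (cj x z (k + 1) * m * cj x z 0) * z =
          cj x z (k + 1 + 1) * (z⁻¹ * m * z) * cj x z 1 := by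
        rw [← cj_conj1 (k+1 : ℤ), show (1:ℤ) = 0 + 1 by ring, ← cj_conj1 0]; group
      rw [e3]
      push_cast
      calc _ = (cj x z 1)⁻¹ * (z⁻¹ * m * z)⁻¹ * (cj x z (k + 1 + 1))⁻¹ * (cj x z (k + 1) * m * cj x z 0) := by group
        _ = (cj x z 1 * (z⁻¹ * m * z)⁻¹ * cj x z (k + 1 + 1)) * (cj x z (k + 1) * m * cj x z 0) := by
          rw [hinv, hinv]
        _ = _ := by rw [hA.eq]; group
  obtain ⟨m, hm, e⟩ := form n le_rfl
  refine ⟨m, e, ?_, hcl n _ ?_ m hm, hcl n _ ?_ m hm⟩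
  · rw [hS] at hm
    clear e
    induction hm using Subgroup.closure_induction with
    | mem g hg => obtain ⟨i, _, _, rfl⟩ := hg; exact cj_sq hx i
    | one => simp
    | mul a b ha hb iha ihb =>
      have hab : Commute a b := by
        refine hcl n b ?_ a ha
        intro i h1 h2
        refine (hcl n _ ?_ b hb).symm
        intro j h3 h4
        apply hCC <;> omega
      rw [show a * b * (a * b) = a * (b * a) * b by group, ← hab.eq, show a * (a * b) * b = (a * a) * (b * b) by group, iha, ihb, one_mul]
    | inv a ha iha => rw [← _root_.mul_inv_rev, iha, inv_one]
  · intro i h1 h2; apply hCC <;> omega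
  · intro i h1 h2; apply hCC <;> omega

/-- commutators -/
def dd (x z : H) (n : ℤ) : H := (cj x z n)⁻¹ * x⁻¹ * cj x z n * x

lemma mem_center_of_gen (hgen : Subgroup.closure {x, z} = ⊤) {g : H} (h1 : Commute x g) (h2 : Commute z g) :
    g ∈ Subgroup.center H := by
  have : (⊤ : Subgroup H) ≤ Subgroup.centralizer {g} := by
    rw [← hgen, Subgroup.closure_le]
    rintro a (rfl | rfl) <;> rw [SetLike.mem_coe, Subgroup.mem_centralizer_singleton_iff]
    · exact h1
    · exact h2
  rw [Subgroup.mem_center_iff]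
  intro a
  exact (Subgroup.mem_centralizer_singleton_iff.1 (this (Subgroup.mem_top a)))

theorem dd_center (hgen : Subgroup.closure {x, z} = ⊤) (hc : Commute z (x ^ 2))
    (h4 : ∀ i ≥ 1, zseq x z i ^ 4 = 1) (h2 : ∀ i ≥ 1, Commute z (zseq x z i ^ 2))
    (δ : H →* Multiplicative ℤ) (hδ : δ x ≠ 1) (n : ℕ) :
    dd x z n ∈ Subgroup.center H ∧ dd x z n ^ 2 = 1 := by
  have hcc : x ^ 2 ∈ Subgroup.center H := mem_center_of_gen hgen (Commute.self_pow x 2) hc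
  let K : Subgroup H :=
    { carrier := {g | g ∈ Subgroup.center H ∧ g ^ 2 ∈ Subgroup.zpowers (x ^ 2)}
      one_mem' := ⟨one_mem _, by simp⟩
      mul_mem' := fun {a b} ha hb => ⟨mul_mem ha.1 hb.1, by
        have : Commute a b := (Subgroup.mem_center_iff.1 hb.1 a)
        rw [this.mul_pow]; exact mul_mem ha.2 hb.2⟩
      inv_mem' := fun {a} ha => ⟨inv_mem ha.1, by rw [inv_pow]; exact inv_mem ha.2⟩ }
  have hKmem : ∀ g, g ∈ K ↔ g ∈ Subgroup.center H ∧ g ^ 2 ∈ Subgroup.zpowers (x ^ 2) := fun g => Iff.rfl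
  have : K.Normal := ⟨fun g hg a => by
    rw [Subgroup.mem_center_iff.1 hg.1 a, mul_inv_cancel_right]; exact hg⟩
  let π := QuotientGroup.mk' K
  have hπ : ∀ g, π g = 1 ↔ g ∈ K := fun g => QuotientGroup.eq_one_iff g
  have hxx : π x * π x = 1 := by
    rw [← map_mul, hπ, ← pow_two]
    exact ⟨hcc, Subgroup.npow_mem_zpowers _ _⟩
  induction n using Nat.strong_induction_on with
  | _ n ih =>
  rcases n with _ | n
  · simp [dd, cj_zero]
  have hC : ∀ j : ℕ, j ≤ n → Commute (cj (π x) (π z) j) (cj (π x) (π z) 0) := by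
    intro j hj
    have h := ih j (by omega)
    have h' : π (dd x z j) = 1 := (hπ _).2 ⟨h.1, by rw [h.2]; exact one_mem _⟩
    simp only [dd, map_mul, map_inv, map_cj] at h'
    rw [cj_zero]
    have := congrArg (fun g => π x * cj (π x) (π z) j * g) h'
    simp only [mul_one] at this
    show _ = _
    rw [← this]; group
  obtain ⟨m, e, hm, hc1, hc2⟩ := seq_form hxx n hC
  set D := dd x z ((n + 1 : ℕ) : ℤ) with hD
  have hinv : ∀ i, (cj (π x) (π z) i)⁻¹ = cj (π x) (π z) i := fun i => inv_eq_of_mul_eq_one_left (cj_sq hxx i)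
  have e1 : π D = π (zseq x z (n + 1) ^ 2) := by
    rw [map_pow, map_zseq, e, hD]
    simp only [dd, map_mul, map_inv, map_cj]
    rw [cj_zero] at hc1 ⊢
    have hx' : (π x)⁻¹ = π x := by simpa [cj_zero] using hinv 0
    rw [hinv, hx']
    push_cast
    set A := cj (π x) (π z) (n + 1)
    set B := π x
    calc A * B * A * B = A * (m * m) * B * A * B := by rw [hm, mul_one]
      _ = A * m * (m * B) * A * B := by group
      _ = A * m * B * (m * A) * B := by rw [hc1.eq]; group
      _ = (A * m * B) ^ 2 := by rw [hc2.eq, pow_two]; group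
  have hζ : (zseq x z (n+1) ^ 2)⁻¹ * D ∈ K := by
    rw [← hπ, map_mul, map_inv, e1, inv_mul_cancel]
  set ζ := (zseq x z (n+1) ^ 2)⁻¹ * D with hζd
  have eD : D = zseq x z (n+1) ^ 2 * ζ := by rw [hζd]; group
  have hζc : ∀ g, Commute g ζ := fun g => Subgroup.mem_center_iff.1 hζ.1 g
  have hzD : Commute z D := by
    rw [eD]; exact (h2 _ (by omega)).mul_right (hζc z)
  have hD2 : D ^ 2 = ζ ^ 2 := by
    rw [eD, (hζc _).mul_pow, ← pow_mul, h4 _ (by omega), one_mul]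
  have hDD : D ^ 2 = 1 := by
    obtain ⟨k, hk⟩ := Subgroup.mem_zpowers_iff.1 hζ.2
    have hd : δ D = 1 := by
      rw [hD]; simp only [dd, map_mul, map_inv]
      rw [mul_comm (δ (cj x z _))⁻¹]; group
    have h1 : δ (x ^ 2) ^ k = 1 := by
      rw [← map_zpow, hk, ← hD2, map_pow, hd, one_pow]
    have : k = 0 := by
      have h1' := congrArg Multiplicative.toAdd h1
      simp only [toAdd_zpow, map_pow, toAdd_pow, toAdd_one, smul_eq_mul] at h1'
      have : Multiplicative.toAdd (δ x) ≠ 0 := fun h => hδ (by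
        rw [← ofAdd_toAdd (δ x), h, ofAdd_zero])
      simpa [this] using h1'
    rw [hD2, ← hk, this, zpow_zero]
  refine ⟨mem_center_of_gen hgen ?_ hzD, hDD⟩
  have hDi : D⁻¹ = D := inv_eq_of_mul_eq_one_left (by rw [← pow_two]; exact hDD)
  have hcx : ∀ g, x * g * x⁻¹ = x⁻¹ * g * x := by
    intro g
    have := Subgroup.mem_center_iff.1 hcc g
    calc x * g * x⁻¹ = x⁻¹ * (x ^ 2 * g) * x⁻¹ := by rw [pow_two]; group
      _ = x⁻¹ * g * x := by rw [← this, pow_two]; group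
  have h5 : x * D * x⁻¹ = D⁻¹ := by
    rw [hD]; simp only [dd]
    set A := cj x z ((n + 1 : ℕ) : ℤ)
    calc _ = (x * A⁻¹ * x⁻¹) * A := by group
      _ = _ := by rw [hcx]; group
  rw [hDi] at h5
  show x * D = D * x
  rw [← mul_inv_eq_iff_eq_mul]; exact h5
end

lemma exists_theta {W : Type*} [Group W] (A : ℤ → W) (hc : ∀ i j, Commute (A i) (A j)) (h2 : ∀ i, A i * A i = 1) :
    ∃ θ : R2 → W, θ 0 = 1 ∧ (∀ f g, θ (f + g) = θ f * θ g) ∧ ∀ k, θ (T k) = A k := by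
  have : IsMulCommutative (Subgroup.closure (Set.range A)) := Subgroup.isMulCommutative_closure (by
    rintro _ ⟨i, rfl⟩ _ ⟨j, rfl⟩; exact hc i j)
  let C := Subgroup.closure (Set.range A)
  let _ : CommGroup C := { (inferInstance : Group C) with mul_comm := fun a b => this.is_comm.comm a b }
  have hC2 : ∀ g : C, g * g = 1 := by
    rintro ⟨g, hg⟩
    have : g * g = 1 := by
      induction hg using Subgroup.closure_induction with
      | mem g hg => obtain ⟨i, rfl⟩ := hg; exact h2 i
      | one => simp
      | mul a b ha hb iha ihb =>
        have hab : a * b = b * a := congrArg Subtype.val (mul_comm (⟨a, ha⟩ : C) ⟨b, hb⟩)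
        rw [show a * b * (a * b) = a * (b * a) * b by group, ← hab, show a * (a * b) * b = (a * a) * (b * b) by group, iha, ihb, one_mul]
      | inv a ha iha => rw [← _root_.mul_inv_rev, iha, inv_one]
    exact Subtype.ext this
  let _ : Module (ZMod 2) (Additive C) := AddCommGroup.zmodModule (by
    intro g; rw [two_nsmul]; exact hC2 g)
  let a : ℤ → Additive C := fun i => Additive.ofMul ⟨A i, Subgroup.subset_closure ⟨i, rfl⟩⟩
  let L := Finsupp.linearCombination (ZMod 2) a
  refine ⟨fun f => ((L f.coeff).toMul : C), ?_, ?_, ?_⟩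
  · simp
  · intro f g
    simp [AddMonoidAlgebra.coeff_add]
  · intro k
    have : (T k : R2).coeff = Finsupp.single k 1 := rfl
    show ((L (T k : R2).coeff).toMul : C).1 = _
    rw [this, Finsupp.linearCombination_single, one_smul]
    rfl

lemma comm_gen_form {C : Type*} [CommGroup C] (c : C) (d : ℕ → C) (hd : ∀ n, d n * d n = 1) {ζ : C}
    (h : ζ ∈ Subgroup.closure ({c} ∪ Set.range d)) : ∃ (m : ℤ) (s : Finset ℕ), ζ = c ^ m * ∏ n ∈ s, d n := by
  have hinv : ∀ n, (d n)⁻¹ = d n := fun n => inv_eq_of_mul_eq_one_left (hd n)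
  have aux : ∀ (s u : Finset ℕ), ∃ v : Finset ℕ, (∏ n ∈ s, d n) * ∏ n ∈ u, d n = ∏ n ∈ v, d n := by
    intro s u
    induction s using Finset.induction_on generalizing u with
    | empty => exact ⟨u, by simp⟩
    | insert n s hn ih =>
      obtain ⟨v, hv⟩ := ih u
      rw [Finset.prod_insert hn, mul_assoc, hv]
      by_cases h : n ∈ v
      · refine ⟨v.erase n, ?_⟩
        rw [← Finset.mul_prod_erase v d h, ← mul_assoc, hd, one_mul]
      · exact ⟨insert n v, by rw [Finset.prod_insert h]⟩
  induction h using Subgroup.closure_induction with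
  | mem g hg =>
    rcases hg with rfl | ⟨n, rfl⟩
    · exact ⟨1, ∅, by simp⟩
    · exact ⟨0, {n}, by simp⟩
  | one => exact ⟨0, ∅, by simp⟩
  | mul a b _ _ iha ihb =>
    obtain ⟨m, s, rfl⟩ := iha
    obtain ⟨m', s', rfl⟩ := ihb
    obtain ⟨v, hv⟩ := aux s s'
    refine ⟨m + m', v, ?_⟩
    rw [← hv, _root_.zpow_add, mul_mul_mul_comm]
  | inv a _ iha =>
    obtain ⟨m, s, rfl⟩ := iha
    refine ⟨-m, s, ?_⟩
    rw [mul_inv, _root_.zpow_neg, ← Finset.prod_inv_distrib]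
    simp [hinv]

lemma two0 : (2 : R2) = 0 := CharTwo.two_eq_zero

lemma TT (n : ℤ) : (T n * T (-n) : R2) = 1 := by rw [← T_add, add_neg_cancel, T_zero]

lemma bar_T (n : ℤ) : bar (T n) = T (-n) := invert_T n
lemma bar_add (f g : R2) : bar (f + g) = bar f + bar g := map_add _ _ _
lemma bar_mul (f g : R2) : bar (f * g) = bar f * bar g := map_mul _ _ _
lemma bar_one : bar 1 = 1 := map_one _
lemma bar_zero : bar 0 = 0 := map_zero _

abbrev M3 := Matrix (Fin 3) (Fin 3) R2

/-- form matrices -/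
def mf (i j : ℤ) (u w : R2) : M3 :=
  !![T i, T i * ((1 + T 1) * bar u), T i * w; 0, T j, T j * u; 0, 0, T i]

lemma ext3 {A B : M3} (h : ∀ i j, A i j = B i j) : A = B := by ext1 i j; exact h i j

lemma mul3 (a b c d e f g h i a' b' c' d' e' f' g' h' i' : R2) :
  !![a, b, c; d, e, f; g, h, i] * !![a', b', c'; d', e', f'; g', h', i'] =
  !![a*a'+b*d'+c*g', a*b'+b*e'+c*h', a*c'+b*f'+c*i';
     d*a'+e*d'+f*g', d*b'+e*e'+f*h', d*c'+e*f'+f*i';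
     g*a'+h*d'+i*g', g*b'+h*e'+i*h', g*c'+h*f'+i*i'] := Matrix.mul_fin_three ..

lemma eq3 {a b c d e f g h i a' b' c' d' e' f' g' h' i' : R2} (h1 : a = a') (h2 : b = b') (h3 : c = c')
   (h4 : d = d') (h5 : e = e') (h6 : f = f') (h7 : g = g') (h8 : h = h') (h9 : i = i') :
  !![a, b, c; d, e, f; g, h, i] = !![a', b', c'; d', e', f'; g', h', i'] := by
  subst h1 h2 h3 h4 h5 h6 h7 h8 h9; rfl

lemma mf_mul (i j i' j' : ℤ) (u w u' w' : R2) : mf i j u w * mf i' j' u' w' =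
    mf (i + i') (j + j') (u' + T (i' - j') * u) (w + w' + T (j' - i') * ((1 + T 1) * (bar u * u'))) := by
  have h1 : T (i' - j') * T j' = (T i' : R2) := by rw [← T_add]; congr 1; ring
  have h2 : T (j' - i') * T i' = (T j' : R2) := by rw [← T_add]; congr 1; ring
  have h3 : bar (u' + T (i' - j') * u) = bar u' + T (j' - i') * bar u := by
    rw [bar_add, bar_mul, bar_T]; congr 3; ring
  rw [mf, mf, mul3, mf, h3, T_add, T_add]
  generalize (T (i' - j') : R2) = a at *
  generalize (T (j' - i') : R2) = b at *
  generalize (T 1 : R2) = t at *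
  generalize (T i : R2) = ti at *
  generalize (T j : R2) = tj at *
  generalize bar u = bu at *
  generalize bar u' = bu' at *
  clear h3
  generalize (T i' : R2) = p at *
  generalize (T j' : R2) = q at *
  refine eq3 ?_ ?_ ?_ ?_ ?_ ?_ ?_ ?_ ?_ <;> grind

lemma mf_one : mf 0 0 0 0 = 1 := by
  rw [mf, Matrix.one_fin_three]; simp [T_zero]

lemma mf_congr {i j i' j' : ℤ} {u w u' w' : R2} (h1 : i = i') (h2 : j = j') (h3 : u = u') (h4 : w = w') :
    mf i j u w = mf i' j' u' w' := by subst h1 h2 h3 h4; rfl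

lemma mf_inv (i j : ℤ) (u w : R2) :
    mf i j u w * mf (-i) (-j) (T (j - i) * u) (w + (1 + T 1) * (bar u * u)) = 1 := by
  rw [mf_mul, ← mf_one]
  have h : T (i - j) * T (j - i) = (1 : R2) := by rw [← T_add]; rw [← T_zero]; congr 1; ring
  have h2 := two0
  rw [show -i - -j = j - i by ring, show -j - -i = i - j by ring]
  refine mf_congr (by ring) (by ring) ?_ ?_ <;> grind

lemma mf_inj {i j i' j' : ℤ} {u w u' w' : R2} (h : mf i j u w = mf i' j' u' w') :
    i = i' ∧ j = j' ∧ u = u' ∧ w = w' := by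
  have h1 : (T i : R2) = T i' := congrFun (congrFun h 0) 0
  have h2 : (T j : R2) = T j' := congrFun (congrFun h 1) 1
  have h3 : (T j * u : R2) = T j' * u' := congrFun (congrFun h 1) 2
  have h4 : (T i * w : R2) = T i' * w' := congrFun (congrFun h 0) 2
  have inj : ∀ a b : ℤ, (T a : R2) = T b → a = b := by
    intro a b hab
    have := congrArg (fun f : R2 => f.coeff a) hab
    simp only [T_apply] at this
    by_contra hne
    simp [Ne.symm hne] at this
  have e1 := inj _ _ h1
  have e2 := inj _ _ h2
  subst e1 e2
  refine ⟨rfl, rfl, ?_, ?_⟩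
  · exact (isUnit_T j).mul_left_cancel h3
  · exact (isUnit_T i).mul_left_cancel h4

abbrev GL3 := GL (Fin 3) R2

/-- predicate -/
def Fm (g : GL3) (i j : ℤ) (u w : R2) : Prop :=
  (g : M3) = mf i j u w ∧ w + T 1 * bar w = (1 + T 1) * (u * bar u)

lemma Fm.one : Fm 1 0 0 0 0 := ⟨by rw [mf_one]; rfl, by simp⟩

lemma Fm.mul {g g' : GL3} {i j i' j' : ℤ} {u w u' w' : R2} (h : Fm g i j u w) (h' : Fm g' i' j' u' w') :
    Fm (g * g') (i + i') (j + j') (u' + T (i' - j') * u) (w + w' + T (j' - i') * ((1 + T 1) * (bar u * u'))) := by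
  refine ⟨by rw [Units.val_mul, h.1, h'.1, mf_mul], ?_⟩
  have e1 := h.2
  have e2 := h'.2
  have h1 : T (i' - j') * T (j' - i') = (1 : R2) := by rw [← T_add]; rw [← T_zero]; congr 1; ring
  have h2 := TT 1
  simp only [bar_add, bar_mul, bar_T, bar_one, bar_bar]
  rw [show -(i' - j') = j' - i' by ring, show -(j' - i') = i' - j' by ring]
  have h3 := two0
  grind

lemma Fm.inv {g : GL3} {i j : ℤ} {u w : R2} (h : Fm g i j u w) :
    Fm g⁻¹ (-i) (-j) (T (j - i) * u) (w + (1 + T 1) * (bar u * u)) := by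
  constructor
  · have h1 : (g : M3) * mf (-i) (-j) (T (j - i) * u) (w + (1 + T 1) * (bar u * u)) = 1 := by
      rw [h.1]; exact mf_inv i j u w
    have h2 : ((g⁻¹ : GL3) : M3) * (g : M3) = 1 := by rw [← Units.val_mul, inv_mul_cancel]; rfl
    calc ((g⁻¹ : GL3) : M3) = ((g⁻¹ : GL3) : M3) * ((g : M3) * mf (-i) (-j) (T (j - i) * u) (w + (1 + T 1) * (bar u * u))) := by rw [h1, mul_one]
      _ = _ := by rw [← mul_assoc, h2, one_mul]
  · have e1 := h.2
    have h1 : T (i - j) * T (j - i) = (1 : R2) := by rw [← T_add]; rw [← T_zero]; congr 1; ring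
    have h2 := TT 1
    simp only [bar_add, bar_mul, bar_T, bar_one, bar_bar]
    rw [show -(j - i) = i - j by ring]
    have h3 := two0
    grind

lemma Fm.congr {g : GL3} {i j i' j' : ℤ} {u w u' w' : R2} (h : Fm g i j u w) (h1 : i = i') (h2 : j = j') (h3 : u = u') (h4 : w = w') :
    Fm g i' j' u' w' := by subst h1 h2 h3 h4; exact h

lemma Fm.uniq {g : GL3} {i j i' j' : ℤ} {u w u' w' : R2} (h : Fm g i j u w) (h' : Fm g i' j' u' w') :
    i = i' ∧ j = j' ∧ u = u' ∧ w = w' := mf_inj (h.1.symm.trans h'.1)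

lemma Fm.eq {g g' : GL3} {i j : ℤ} {u w : R2} (h : Fm g i j u w) (h' : Fm g' i j u w) : g = g' :=
  Units.ext (h.1.trans h'.1.symm)

/-- the matrix e -/
def emat : M3 := !![0, 0, T 3; 0, T 2, 0; T 2, 0, 0]
/-- inverse -/
def emati : M3 := !![0, 0, T (-2); 0, T (-2), 0; T (-3), 0, 0]

lemma T2e : (T 2 : R2) = T 1 ^ 2 := by rw [T_pow]; rfl
lemma T3e : (T 3 : R2) = T 1 ^ 3 := by rw [T_pow]; rfl
lemma T4e : (T 4 : R2) = T 1 ^ 4 := by rw [T_pow]; rfl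
lemma T5e : (T 5 : R2) = T 1 ^ 5 := by rw [T_pow]; rfl
lemma Tm2e : (T (-2) : R2) = T (-1) ^ 2 := by rw [T_pow]; rfl
lemma Tm3e : (T (-3) : R2) = T (-1) ^ 3 := by rw [T_pow]; rfl

/-- xt -/
def xt : GL3 := ⟨mf 1 1 1 (T 1), mf (-1) (-1) (T (1 - 1) * 1) (T 1 + (1 + T 1) * (bar 1 * 1)), mf_inv _ _ _ _, by
  rw [mf_mul, ← mf_one]
  have h := two0
  refine mf_congr (by ring) (by ring) ?_ ?_ <;> simp [T_zero] <;> grind⟩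

/-- et -/
def et : GL3 := ⟨emat, emati, by
  rw [emat, emati, mul3, Matrix.one_fin_three, T2e, T3e, Tm2e, Tm3e]
  have h := TT 1
  generalize (T 1 : R2) = t at *
  generalize (T (-1) : R2) = s at *
  refine eq3 ?_ ?_ ?_ ?_ ?_ ?_ ?_ ?_ ?_ <;> grind, by
  rw [emat, emati, mul3, Matrix.one_fin_three, T2e, T3e, Tm2e, Tm3e]
  have h := TT 1
  generalize (T 1 : R2) = t at *
  generalize (T (-1) : R2) = s at *
  refine eq3 ?_ ?_ ?_ ?_ ?_ ?_ ?_ ?_ ?_ <;> grind⟩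

/-- yt -/
def yt : GL3 := et * xt⁻¹

lemma Fx : Fm xt 1 1 1 (T 1) := ⟨rfl, by
  rw [bar_T, TT, bar_one]; ring⟩

lemma xti : ((xt⁻¹ : GL3) : M3) = !![T (-1), T (-1) * (1 + T 1), T (-1); 0, T (-1), T (-1); 0, 0, T (-1)] := by
  have h2 := two0
  show mf _ _ _ _ = _
  rw [mf, sub_self, T_zero, mul_one, bar_one]
  generalize (T 1 : R2) = t at *
  generalize (T (-1) : R2) = s at *
  refine eq3 rfl ?_ ?_ rfl rfl ?_ rfl rfl rfl <;> grind

lemma xtm : (xt : M3) = !![T 1, T 1 * (1 + T 1), T 1 * T 1; 0, T 1, T 1; 0, 0, T 1] := by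
  show mf _ _ _ _ = _
  rw [mf, bar_one, mul_one, mul_one]

lemma ytm : (yt : M3) = !![0, 0, T 2; 0, T 1, T 1; T 1, T 1 * (1 + T 1), T 1] := by
  rw [yt, Units.val_mul, xti]
  show emat * _ = _
  rw [emat, mul3, T2e, T3e]
  have h := TT 1
  generalize (T 1 : R2) = t at *
  generalize (T (-1) : R2) = s at *
  refine eq3 ?_ ?_ ?_ ?_ ?_ ?_ ?_ ?_ ?_ <;> grind

lemma Fz : Fm (yt * xt * yt) 4 3 1 1 := by
  constructor
  · rw [yt, inv_mul_cancel_right, Units.val_mul, ← yt, ytm]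
    show emat * _ = _
    rw [emat, mul3, mf, T2e, T3e, T4e, bar_one]
    generalize (T 1 : R2) = t at *
    refine eq3 ?_ ?_ ?_ ?_ ?_ ?_ ?_ ?_ ?_ <;> grind
  · simp [bar_one]

lemma xt4 : xt ^ 4 = yt ^ 3 := by
  have h2 := two0
  have hx : Fm (xt ^ 4) 4 4 0 0 := by
    have h := (Fx.mul Fx)
    have h := h.mul h
    rw [← pow_two, ← pow_two, ← pow_mul] at h
    refine h.congr (by norm_num) (by norm_num) ?_ ?_
    · rw [sub_self, sub_self, T_zero]; grind
    · rw [sub_self, sub_self, T_zero, bar_one]; simp only [bar_add, bar_mul, bar_one]; grind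
  have hy : ((yt ^ 3 : GL3) : M3) = mf 4 4 0 0 := by
    rw [pow_succ, pow_two, Units.val_mul, Units.val_mul, ytm, mul3, mul3, mf]
    rw [T2e, T4e, bar_zero]
    generalize (T 1 : R2) = t at *
    refine eq3 ?_ ?_ ?_ ?_ ?_ ?_ ?_ ?_ ?_ <;> grind
  exact Units.ext (hx.1.trans hy.symm)

lemma xseq_eq {H : Type*} [Group H] (x y : H) (n : ℕ) : xseq x y n = zseq x (y * x * y) n := by
  induction n with
  | zero => rfl
  | succ n ih => simp only [xseq, zseq, ih]

lemma Fseq (n : ℕ) : ∃ i u w, Fm (zseq xt (yt * xt * yt) n) i i u w ∧ (1 ≤ n → i = 0) := by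
  induction n with
  | zero => exact ⟨1, 1, T 1, Fx, by omega⟩
  | succ n ih =>
    obtain ⟨i, u, w, h, -⟩ := ih
    have h1 := (Fz.inv.mul h.inv).mul (Fz.mul h)
    have e : zseq xt (yt * xt * yt) (n + 1) = (yt * xt * yt)⁻¹ * (zseq xt (yt * xt * yt) n)⁻¹ * (yt * xt * yt * (zseq xt (yt * xt * yt) n)) := by
      simp only [zseq, br]; group
    rw [← e] at h1
    exact ⟨0, _, _, h1.congr (by ring) (by ring) rfl rfl, fun _ => rfl⟩

lemma Fsq {g : GL3} {u w : R2} (h : Fm g 0 0 u w) : Fm (g ^ 2) 0 0 0 ((1 + T 1) * (bar u * u)) := by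
  have h2 := two0
  rw [pow_two]
  refine (h.mul h).congr (by ring) (by ring) ?_ ?_ <;> simp [T_zero] <;> grind

lemma rel4 (n : ℕ) (hn : 1 ≤ n) : zseq xt (yt * xt * yt) n ^ 4 = 1 := by
  obtain ⟨i, u, w, h, hi⟩ := Fseq n
  rw [hi hn] at h
  have := Fsq (Fsq h)
  rw [← pow_mul] at this
  exact this.eq (Fm.one.congr rfl rfl rfl (by simp))

lemma rel2 {g : GL3} {v : R2} (h : Fm g 0 0 0 v) : Commute (yt * xt * yt) g := by
  have h2 := two0
  refine (Fz.mul h).eq ((h.mul Fz).congr (by ring) (by ring) ?_ ?_)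
  · simp [T_zero]
  · simp [bar_zero]; ring

lemma br_eq_one {H : Type*} [Group H] {a b : H} (h : Commute b a) : br a b = 1 := by
  have h' : a * b = b * a := h.eq.symm
  simp only [br]
  rw [mul_assoc, h']; group

lemma map_xseq {H K : Type*} [Group H] [Group K] (f : H →* K) (x y : H) (n : ℕ) :
    f (xseq x y n) = xseq (f x) (f y) n := by
  rw [xseq_eq, xseq_eq, map_zseq]; simp

lemma map_br {H K : Type*} [Group H] [Group K] (f : H →* K) (x y : H) :
    f (br x y) = br (f x) (f y) := by simp [br]

/-- criterion for factoring -/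
lemma rels_hold {K : Type*} [Group K] (x y : K) (h0 : x ^ 4 = y ^ 3) (h1 : Commute (y * x * y) (x ^ 2))
    (h4 : ∀ i ≥ 1, zseq x (y * x * y) i ^ 4 = 1) (h2 : ∀ i ≥ 1, Commute (y * x * y) (zseq x (y * x * y) i ^ 2)) :
    ∀ r ∈ b42Rels, FreeGroup.lift ![x, y] r = 1 := by
  rintro r ((( rfl | rfl) | ⟨i, hi, rfl⟩) | ⟨i, hi, rfl⟩)
  · simp [h0]
  · rw [map_br]; apply br_eq_one; simpa using h1
  · rw [map_pow, map_xseq, xseq_eq]; simpa using h4 i hi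
  · rw [map_br, map_pow, map_xseq, xseq_eq]; apply br_eq_one; simpa using h2 i hi

lemma relsT : ∀ r ∈ b42Rels, FreeGroup.lift ![xt, yt] r = 1 := by
  apply rels_hold
  · exact xt4
  · have h2 := two0
    rw [pow_two]
    refine (Fz.mul (Fx.mul Fx)).eq (((Fx.mul Fx).mul Fz).congr (by ring) (by ring) ?_ ?_)
    · simp only [sub_self, T_zero]; grind
    · simp only [sub_self, T_zero, bar_add, bar_mul, bar_one]; grind
  · exact rel4
  · intro i hi
    obtain ⟨j, u, w, h, hj⟩ := Fseq i
    rw [hj hi] at h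
    exact rel2 (Fsq h)

/-- the presented group -/
abbrev GG := PresentedGroup b42Rels
def gx : GG := PresentedGroup.of 0
def gy : GG := PresentedGroup.of 1
def gz : GG := gy * gx * gy
def rho : GG →* GL3 := PresentedGroup.toGroup relsT
/-- matrix -/
def rm (g : GG) : M3 := ((rho g : GL3) : M3)

lemma rho_x : rho gx = xt := by
  simp [rho, gx, PresentedGroup.toGroup.of]
lemma rho_y : rho gy = yt := by
  simp [rho, gy, PresentedGroup.toGroup.of]
lemma rho_z : rho gz = yt * xt * yt := by simp [gz, rho_x, rho_y]

lemma rm_mul (g h : GG) : rm (g * h) = rm g * rm h := by simp [rm]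
lemma rm_one : rm 1 = 1 := by simp [rm]
lemma rm_inv_mul (g : GG) : rm g⁻¹ * rm g = 1 := by rw [← rm_mul, inv_mul_cancel, rm_one]
lemma rm_mul_inv (g : GG) : rm g * rm g⁻¹ = 1 := by rw [← rm_mul, mul_inv_cancel, rm_one]

lemma mk_eq : (PresentedGroup.mk b42Rels) = FreeGroup.lift ![gx, gy] := by
  ext i
  fin_cases i <;> simp [gx, gy] <;> rfl

lemma mk_rel {r : FreeGroup (Fin 2)} (h : r ∈ b42Rels) : FreeGroup.lift ![gx, gy] r = 1 := by
  rw [← mk_eq]; exact PresentedGroup.one_of_mem h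

lemma gclosure : Subgroup.closure {gx, gy} = ⊤ := by
  rw [← PresentedGroup.closure_range_of]
  congr 1
  ext g
  simp [Fin.exists_fin_two, gx, gy, eq_comm]

lemma gen_ind {p : GG → Prop} (hx : p gx) (hy : p gy) (h1 : p 1) (hm : ∀ a b, p a → p b → p (a * b))
    (hi : ∀ a, p a → p a⁻¹) (g : GG) : p g := by
  have hg : g ∈ Subgroup.closure {gx, gy} := by rw [gclosure]; trivial
  induction hg using Subgroup.closure_induction with
  | mem g hg => rcases hg with rfl | rfl <;> assumption
  | one => exact h1
  | mul a b _ _ iha ihb => exact hm a b iha ihb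
  | inv a _ iha => exact hi a iha

lemma g43 : gx ^ 4 = gy ^ 3 := by
  have := mk_rel (r := (FreeGroup.of 0) ^ 4 * ((FreeGroup.of 1) ^ 3)⁻¹) (Or.inl (Or.inl (Or.inl rfl)))
  simpa [mul_inv_eq_one] using this

lemma commute_of_br {H : Type*} [Group H] {a b : H} (h : br a b = 1) : Commute b a := by
  show b * a = a * b
  have : b * a * br a b = a * b := by simp only [br]; group
  rw [← this, h, mul_one]

lemma gc : Commute gz (gx ^ 2) := by
  have := mk_rel (r := br ((FreeGroup.of 0) ^ 2) (FreeGroup.of 1 * FreeGroup.of 0 * FreeGroup.of 1)) (Or.inl (Or.inl (Or.inr rfl)))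
  rw [map_br] at this
  simpa [gz] using commute_of_br this

lemma gs4 (i : ℕ) (hi : i ≥ 1) : zseq gx gz i ^ 4 = 1 := by
  have := mk_rel (Or.inl (Or.inr ⟨i, hi, rfl⟩))
  rw [map_pow, map_xseq, xseq_eq] at this
  simpa [gz] using this

lemma gs2 (i : ℕ) (hi : i ≥ 1) : Commute gz (zseq gx gz i ^ 2) := by
  have := mk_rel (Or.inr ⟨i, hi, rfl⟩)
  rw [map_br, map_pow, map_xseq, xseq_eq] at this
  simpa [gz] using commute_of_br this

/-- degree -/
def gdelta : GG →* Multiplicative ℤ := PresentedGroup.toGroup (rels := b42Rels)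
  (f := ![Multiplicative.ofAdd 3, Multiplicative.ofAdd 4]) (by
    have hseq : ∀ (x z : Multiplicative ℤ) (i : ℕ), i ≥ 1 → zseq x z i = 1 := by
      intro x z i hi
      obtain ⟨i, rfl⟩ := Nat.exists_eq_add_of_le' hi
      simp only [zseq]
      exact br_eq_one (Commute.all _ _)
    apply rels_hold
    · rfl
    · exact Commute.all _ _
    · intro i hi; rw [hseq _ _ i hi, one_pow]
    · intro i hi; exact Commute.all _ _)

lemma gdelta_x : gdelta gx ≠ 1 := by
  have : gdelta gx = Multiplicative.ofAdd 3 := by simp [gdelta, gx, PresentedGroup.toGroup.of]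
  rw [this]; decide

/-- form matrix -/
def Jm : M3 := !![0, 0, 1; 0, 1 + T 1, 0; T 1, 0, 0]

abbrev barM (A : M3) : M3 := A.map (LaurentPolynomial.invert (R := ZMod 2))

lemma barM_mul (A B : M3) : barM (A * B) = barM A * barM B := Matrix.map_mul
lemma barM_one : barM 1 = 1 := by simp [barM]

/-- the parabolic subgroup -/
def PP : Subgroup GG := Subgroup.closure {gx, gz}

lemma map3 (a b c d e f g h i : R2) : barM !![a, b, c; d, e, f; g, h, i] =
  !![bar a, bar b, bar c; bar d, bar e, bar f; bar g, bar h, bar i] := by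
  ext1 r s; fin_cases r <;> fin_cases s <;> rfl

lemma tr3 (a b c d e f g h i : R2) : (!![a, b, c; d, e, f; g, h, i] : M3)ᵀ =
  !![a, d, g; b, e, h; c, f, i] := by
  ext1 r s; fin_cases r <;> fin_cases s <;> rfl

lemma yti : ((yt⁻¹ : GL3) : M3) = !![T (-1), T (-1) + 1, T (-1); T (-2), T (-1), 0; T (-2), 0, 0] := by
  rw [yt, _root_.mul_inv_rev, inv_inv, Units.val_mul, xtm]
  show _ * emati = _
  rw [emati, mul3, Tm2e, Tm3e]
  have h := TT 1
  generalize (T 1 : R2) = t at *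
  generalize (T (-1) : R2) = s at *
  refine eq3 ?_ ?_ ?_ ?_ ?_ ?_ ?_ ?_ ?_ <;> grind

lemma form_inv (g : GG) : Jm * barM (rm g) = (rm g⁻¹)ᵀ * Jm := by
  induction g using gen_ind with
  | hx =>
    rw [rm, rm, map_inv, rho_x, xti, xtm, map3, tr3, Jm, mul3, mul3]
    simp only [bar_add, bar_mul, bar_T, bar_one, bar_zero]
    have h := TT 1
    generalize (T 1 : R2) = t at *
    generalize (T (-1) : R2) = s at *
    refine eq3 ?_ ?_ ?_ ?_ ?_ ?_ ?_ ?_ ?_ <;> grind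
  | hy =>
    rw [rm, rm, map_inv, rho_y, yti, ytm, map3, tr3, Jm, mul3, mul3]
    simp only [bar_add, bar_mul, bar_T, bar_one, bar_zero]
    rw [Tm2e]
    have h := TT 1
    generalize (T 1 : R2) = t at *
    generalize (T (-1) : R2) = s at *
    refine eq3 ?_ ?_ ?_ ?_ ?_ ?_ ?_ ?_ ?_ <;> grind
  | h1 => rw [inv_one, rm_one, barM_one, Matrix.transpose_one, mul_one, one_mul]
  | hm a b ha hb =>
    rw [rm_mul, barM_mul, ← mul_assoc, ha, mul_assoc, hb, _root_.mul_inv_rev, rm_mul, Matrix.transpose_mul, mul_assoc]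
  | hi a ha =>
    rw [inv_inv]
    have h1 : (rm a)ᵀ * (rm a⁻¹)ᵀ = 1 := by
      rw [← Matrix.transpose_mul, rm_inv_mul, Matrix.transpose_one]
    have h2 : barM (rm a) * barM (rm a⁻¹) = 1 := by rw [← barM_mul, rm_mul_inv, barM_one]
    calc Jm * barM (rm a⁻¹) = ((rm a)ᵀ * (rm a⁻¹)ᵀ) * Jm * barM (rm a⁻¹) := by rw [h1, one_mul]
      _ = (rm a)ᵀ * ((rm a⁻¹)ᵀ * Jm) * barM (rm a⁻¹) := by simp only [mul_assoc]
      _ = (rm a)ᵀ * Jm * (barM (rm a) * barM (rm a⁻¹)) := by rw [← ha]; simp only [mul_assoc]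
      _ = _ := by rw [h2, mul_one]

lemma inv31 (g : GG) : T 1 * rm g⁻¹ 2 0 = bar (rm g 2 0) := by
  have h := congrFun (congrFun (form_inv g) 0) 0
  simp only [Matrix.mul_apply, Fin.sum_univ_three, Matrix.transpose_apply, Jm, Matrix.map_apply] at h
  simp at h
  rw [mul_comm]; exact h.symm

/-- Fm for P -/
lemma P_form {p : GG} (hp : p ∈ PP) : ∃ i j u w, Fm (rho p) i j u w := by
  induction hp using Subgroup.closure_induction with
  | mem g hg =>
    rcases hg with rfl | rfl
    · exact ⟨_, _, _, _, by rw [rho_x]; exact Fx⟩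
    · exact ⟨_, _, _, _, by rw [rho_z]; exact Fz⟩
  | one => exact ⟨0, 0, 0, 0, by rw [map_one]; exact Fm.one⟩
  | mul a b _ _ iha ihb =>
    obtain ⟨_, _, _, _, h⟩ := iha
    obtain ⟨_, _, _, _, h'⟩ := ihb
    exact ⟨_, _, _, _, by rw [map_mul]; exact h.mul h'⟩
  | inv a _ iha =>
    obtain ⟨_, _, _, _, h⟩ := iha
    exact ⟨_, _, _, _, by rw [map_inv]; exact h.inv⟩

set_option linter.unusedTactic false

lemma Fm.mul' {g g' : GL3} {i i' : ℤ} {u w u' w' : R2} (h : Fm g i i u w) (h' : Fm g' i' i' u' w') :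
    Fm (g * g') (i + i') (i + i') (u + u') (w + w' + (1 + T 1) * (bar u * u')) := by
  refine (h.mul h').congr rfl rfl ?_ ?_
  · rw [sub_self, T_zero]; ring
  · rw [sub_self, T_zero]; ring

lemma Fm.inv' {g : GL3} {i : ℤ} {u w : R2} (h : Fm g i i u w) :
    Fm g⁻¹ (-i) (-i) u (w + (1 + T 1) * (bar u * u)) := by
  refine h.inv.congr rfl rfl ?_ rfl
  rw [sub_self, T_zero, one_mul]

lemma Fm.zpow0 {g : GL3} {i : ℤ} {w : R2} (h : Fm g i i 0 w) (m : ℤ) :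
    Fm (g ^ m) (m * i) (m * i) 0 ((m : R2) * w) := by
  have h2 := two0
  induction m with
  | zero => simpa using Fm.one
  | succ n ih =>
    rw [_root_.zpow_add, zpow_one]
    refine (ih.mul' h).congr (by push_cast; ring) (by push_cast; ring) (by simp) ?_
    rw [bar_zero]; push_cast; ring
  | pred n ih =>
    rw [sub_eq_add_neg, _root_.zpow_add, _root_.zpow_neg_one]
    refine (ih.mul' h.inv').congr (by push_cast; ring) (by push_cast; ring) (by simp) ?_
    rw [bar_zero]; push_cast; grind

lemma Fm.zpowd {g : GL3} {i j : ℤ} (h : Fm g i j 0 0) (m : ℤ) :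
    Fm (g ^ m) (m * i) (m * j) 0 0 := by
  induction m with
  | zero => simpa using Fm.one
  | succ n ih =>
    rw [_root_.zpow_add, zpow_one]
    exact (ih.mul h).congr (by push_cast; ring) (by push_cast; ring) (by simp) (by simp)
  | pred n ih =>
    rw [sub_eq_add_neg, _root_.zpow_add, _root_.zpow_neg_one]
    exact (ih.mul h.inv).congr (by push_cast; ring) (by push_cast; ring) (by simp) (by simp)

lemma Fzpow (m : ℤ) : ∃ u w, Fm ((yt * xt * yt) ^ m) (m * 4) (m * 3) u w := by
  induction m with
  | zero => exact ⟨0, 0, by simpa using Fm.one⟩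
  | succ n ih =>
    obtain ⟨u, w, h⟩ := ih
    rw [_root_.zpow_add, zpow_one]
    exact ⟨_, _, (h.mul Fz).congr (by push_cast; ring) (by push_cast; ring) rfl rfl⟩
  | pred n ih =>
    obtain ⟨u, w, h⟩ := ih
    rw [sub_eq_add_neg, _root_.zpow_add, _root_.zpow_neg_one]
    exact ⟨_, _, (h.mul Fz.inv).congr (by push_cast; ring) (by push_cast; ring) rfl rfl⟩

lemma Fcj (k : ℤ) : ∃ w, Fm (rho (cj gx gz k)) 1 1 (T k) w := by
  obtain ⟨u, w, h⟩ := Fzpow k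
  rw [map_cj, rho_x, rho_z, cj, _root_.zpow_neg]
  refine ⟨_, ((h.inv.mul Fx).mul h).congr (by ring) (by ring) ?_ rfl⟩
  have h1 : k * 4 - k * 3 = k := by ring
  have h2 : k * 3 - k * 4 = -k := by ring
  have h3 := TT k
  have h4 := two0
  rw [h1, h2, sub_self, T_zero]
  grind

lemma Fcomm {g g' : GL3} {i i' : ℤ} {u w u' w' : R2} (h : Fm g i i u w) (h' : Fm g' i' i' u' w') :
    Fm (g⁻¹ * g'⁻¹ * g * g') 0 0 0 ((1 + T 1) * (bar u * u' + bar u' * u)) := by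
  have h2 := two0
  refine (((h.inv'.mul' h'.inv').mul' h).mul' h').congr (by ring) (by ring) ?_ ?_
  · grind
  · simp only [bar_add]; grind

/-- coordinates of commutators -/
def vv (n : ℤ) : R2 := T (-n) + T n + T (1 - n) + T (n + 1)

lemma Fdd (n : ℤ) : Fm (rho (dd gx gz n)) 0 0 0 (vv n) := by
  obtain ⟨w, h⟩ := Fcj n
  have hx := Fx
  rw [← rho_x] at hx
  simp only [dd, map_mul, map_inv]
  refine (Fcomm h hx).congr rfl rfl rfl ?_
  rw [vv, bar_T, bar_one, show (1 - n) = 1 + (-n) by ring, T_add, T_add]; ring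

lemma Fc : Fm (rho (gx ^ 2)) 2 2 0 (1 + T 1) := by
  rw [map_pow, rho_x, pow_two]
  have h2 := two0
  refine (Fx.mul' Fx).congr rfl rfl ?_ ?_
  · grind
  · rw [bar_one]; grind

abbrev HP := ↥PP
def hx : HP := ⟨gx, Subgroup.subset_closure (Or.inl rfl)⟩
def hz : HP := ⟨gz, Subgroup.subset_closure (Or.inr rfl)⟩

lemma hgen : Subgroup.closure {hx, hz} = ⊤ := by
  refine Eq.trans ?_ (Subgroup.closure_closure_coe_preimage (k := {gx, gz}))
  congr 1
  ext ⟨g, hg⟩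
  simp only [Set.mem_insert_iff, Set.mem_singleton_iff, hx, hz]
  exact or_congr Subtype.ext_iff Subtype.ext_iff

lemma hdd (n : ℕ) : dd hx hz n ∈ Subgroup.center HP ∧ dd hx hz n ^ 2 = 1 := by
  have hs : ∀ i, ((zseq hx hz i : HP) : GG) = zseq gx gz i := fun i => map_zseq PP.subtype hx hz i
  apply dd_center hgen (δ := gdelta.comp PP.subtype)
  · exact Subtype.ext gc
  · intro i hi; apply Subtype.ext; push_cast; rw [hs]; exact gs4 i hi
  · intro i hi; apply Subtype.ext; push_cast; rw [hs]; exact gs2 i hi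
  · exact gdelta_x

lemma hcc : hx ^ 2 ∈ Subgroup.center HP :=
  mem_center_of_gen hgen (Commute.self_pow _ 2) (Subtype.ext gc)

/-- Z -/
def ZH : Subgroup HP := Subgroup.closure ({hx ^ 2} ∪ Set.range fun n : ℕ => dd hx hz (n + 1 : ℕ))

lemma ZH_center : ZH ≤ Subgroup.center HP := by
  rw [ZH, Subgroup.closure_le]
  rintro _ (rfl | ⟨n, rfl⟩)
  · exact hcc
  · exact (hdd _).1

instance : ZH.Normal := ⟨fun g hg a => by
    rw [Subgroup.mem_center_iff.1 (ZH_center hg) a, mul_inv_cancel_right]; exact hg⟩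

lemma vv_sum {s : Finset ℕ} {m : ℤ} (h : (m : R2) * (1 + T 1) + ∑ n ∈ s, vv (n + 1 : ℕ) = 0) : s = ∅ ∧ Even m := by
  have hs : s = ∅ := by
    by_contra hne
    have hne' := Finset.nonempty_iff_ne_empty.2 hne
    set n := s.max' hne' with hn
    have hmem := s.max'_mem hne'
    have hle : ∀ k ∈ s, k ≤ n := fun k hk => s.le_max' k hk
    have h' := congrArg (fun f : R2 => f.coeff (n + 2 : ℤ)) h
    simp only [AddMonoidAlgebra.coeff_add, Finsupp.add_apply, AddMonoidAlgebra.coeff_sum, Finsupp.finsetSum_apply] at h'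
    have e1 : ∀ k ∈ s, (vv (k + 1 : ℕ)).coeff (n + 2 : ℤ) = if k = n then 1 else 0 := by
      intro k hk
      have := hle k hk
      rw [vv]
      simp only [AddMonoidAlgebra.coeff_add, Finsupp.add_apply, T_apply]
      push_cast
      rw [if_neg (by omega), if_neg (by omega), if_neg (by omega)]
      by_cases hkn : k = n
      · rw [if_pos (by omega), if_pos hkn]; simp
      · rw [if_neg (by omega), if_neg hkn]; simp
    have e2 : ((m : R2) * (1 + T 1)).coeff (n + 2 : ℤ) = 0 := by
      rw [← zsmul_eq_mul, AddMonoidAlgebra.coeff_smul, Finsupp.smul_apply, AddMonoidAlgebra.coeff_add, Finsupp.add_apply,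
        ← T_zero, T_apply, T_apply, if_neg (by omega), if_neg (by omega)]
      simp
    rw [e2, Finset.sum_congr rfl e1, Finset.sum_ite_eq', if_pos hmem] at h'
    simp at h'
  refine ⟨hs, ?_⟩
  rw [hs, Finset.sum_empty, add_zero] at h
  have h' := congrArg (fun f : R2 => f.coeff 0) h
  simp only [← zsmul_eq_mul, AddMonoidAlgebra.coeff_smul, Finsupp.smul_apply, AddMonoidAlgebra.coeff_add, Finsupp.add_apply,
        ← T_zero (R := ZMod 2), T_apply] at h'
  simp at h'
  rw [even_iff_two_dvd]
  exact (ZMod.intCast_zmod_eq_zero_iff_dvd m 2).1 h'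

lemma ZH_zero {ζ : HP} (hζ : ζ ∈ ZH) {i : ℤ} {u : R2} (h : Fm (rho ζ) i i u 0) : ∃ l : ℤ, (ζ : GG) = gx ^ (4 * l) := by
  let C := Subgroup.center HP
  let _ : CommGroup C := { (inferInstance : Group C) with mul_comm := fun a b => Subtype.ext (Subgroup.mem_center_iff.1 b.2 a) }
  let c : C := ⟨hx ^ 2, hcc⟩
  let d : ℕ → C := fun n => ⟨dd hx hz (n + 1 : ℕ), (hdd _).1⟩
  have hle : ZH ≤ (Subgroup.closure ({c} ∪ Set.range d)).map C.subtype := by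
    rw [ZH, Subgroup.closure_le]
    rintro _ (rfl | ⟨n, rfl⟩)
    · exact ⟨c, Subgroup.subset_closure (Or.inl rfl), rfl⟩
    · exact ⟨d n, Subgroup.subset_closure (Or.inr ⟨n, rfl⟩), rfl⟩
  obtain ⟨ζ', hζ', rfl⟩ := hle hζ
  obtain ⟨m, s, rfl⟩ := comm_gen_form c d (fun n => Subtype.ext (by
    have := (hdd (n + 1)).2
    rw [pow_two] at this; exact this)) hζ'
  let f : C →* GL3 := (rho.comp PP.subtype).comp C.subtype
  have hfc : Fm (f c) 2 2 0 (1 + T 1) := Fc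
  have hfd : ∀ n, Fm (f (d n)) 0 0 0 (vv (n + 1 : ℕ)) := by
    intro n
    have : ((dd hx hz (n + 1 : ℕ) : HP) : GG) = dd gx gz (n + 1 : ℕ) := rfl
    show Fm (rho (dd hx hz (n + 1 : ℕ) : HP)) _ _ _ _
    rw [this]
    exact Fdd _
  have hprod : Fm (f (∏ n ∈ s, d n)) 0 0 0 (∑ n ∈ s, vv (n + 1 : ℕ)) := by
    clear h hζ' hζ
    induction s using Finset.induction_on with
    | empty => simpa using Fm.one
    | insert n s hn ih =>
      rw [Finset.prod_insert hn, Finset.sum_insert hn, map_mul]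
      exact ((hfd n).mul' ih).congr (by ring) (by ring) (by ring) (by rw [bar_zero]; ring)
  have htot := ((hfc.zpow0 m).mul' hprod)
  rw [← map_zpow, ← map_mul] at htot
  have hw := (htot.uniq h).2.2.2
  rw [bar_zero, zero_mul, mul_zero, add_zero] at hw
  obtain ⟨rfl, l, rfl⟩ := vv_sum hw
  refine ⟨l, ?_⟩
  rw [Finset.prod_empty, mul_one]
  show (gx ^ 2) ^ (l + l) = _
  rw [← zpow_natCast, ← _root_.zpow_mul]; congr 1; push_cast; ring

/-- unipotent part -/
def UH : Subgroup HP := Subgroup.closure (Set.range (cj hx hz))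

lemma exists_th : ∃ θ : R2 → HP ⧸ ZH, θ 0 = 1 ∧ ∀ g ∈ UH, ∃ k u w, Fm (rho g) k k u w ∧ θ u = QuotientGroup.mk' ZH g := by
  let π := QuotientGroup.mk' ZH
  have hπ : ∀ g, π g = 1 ↔ g ∈ ZH := fun g => QuotientGroup.eq_one_iff g
  have hxx : π hx * π hx = 1 := by
    rw [← map_mul, hπ, ← pow_two]
    exact Subgroup.subset_closure (Or.inl rfl)
  have h0 : ∀ n : ℕ, Commute (cj (π hx) (π hz) n) (cj (π hx) (π hz) 0) := by
    intro n
    rcases n with _ | n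
    · exact Commute.refl _
    have h' : π (dd hx hz (n + 1 : ℕ)) = 1 := (hπ _).2 (Subgroup.subset_closure (Or.inr ⟨n, rfl⟩))
    simp only [dd, map_mul, map_inv, map_cj] at h'
    rw [cj_zero]
    have := congrArg (fun g => π hx * cj (π hx) (π hz) (n + 1 : ℕ) * g) h'
    simp only [mul_one] at this
    show _ = _
    rw [← this]; group
  have h1 : ∀ i j : ℤ, j ≤ i → Commute (cj (π hx) (π hz) i) (cj (π hx) (π hz) j) := by
    intro i j h2
    have := comm_shift j (h0 (i - j).toNat)
    rw [Int.toNat_of_nonneg (by omega)] at this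
    simpa using this
  have hCC : ∀ i j : ℤ, Commute (cj (π hx) (π hz) i) (cj (π hx) (π hz) j) := by
    intro i j
    rcases le_total j i with h | h
    · exact h1 i j h
    · exact (h1 j i h).symm
  obtain ⟨θ, t0, ta, tT⟩ := exists_theta _ hCC (cj_sq hxx)
  refine ⟨θ, t0, fun g hg => ?_⟩
  induction hg using Subgroup.closure_induction with
  | mem g hg =>
    obtain ⟨k, rfl⟩ := hg
    obtain ⟨w, h⟩ := Fcj k
    refine ⟨1, T k, w, h, ?_⟩
    rw [tT, map_cj]
  | one => exact ⟨0, 0, 0, by simpa using Fm.one, by rw [t0, map_one]⟩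
  | mul a b _ _ iha ihb =>
    obtain ⟨k, u, w, h, e⟩ := iha
    obtain ⟨k', u', w', h', e'⟩ := ihb
    refine ⟨_, _, _, by rw [Subgroup.coe_mul, map_mul]; exact h.mul' h', ?_⟩
    rw [ta, e, e', map_mul]
  | inv a _ iha =>
    obtain ⟨k, u, w, h, e⟩ := iha
    refine ⟨_, _, _, by rw [Subgroup.coe_inv, map_inv]; exact h.inv', ?_⟩
    rw [map_inv, ← e, eq_inv_iff_mul_eq_one, ← ta, CharTwo.add_self_eq_zero, t0]

lemma UH_zero {g : HP} (hg : g ∈ UH) {i : ℤ} (h : Fm (rho g) i i 0 0) : ∃ l : ℤ, (g : GG) = gx ^ (4 * l) := by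
  obtain ⟨θ, t0, ht⟩ := exists_th
  obtain ⟨k, u, w, h', e⟩ := ht g hg
  have := (h.uniq h').2.2.1
  rw [← this, t0] at e
  exact ZH_zero ((QuotientGroup.eq_one_iff g).1 e.symm) h

instance : UH.Normal := by
  rw [← Subgroup.normalizer_eq_top_iff, eq_top_iff, ← hgen, Subgroup.closure_le]
  have hcz : ∀ e : ℤ, ∀ g ∈ UH, hz ^ (-e) * g * hz ^ e ∈ UH := by
    intro e g hg
    have hle : UH ≤ UH.comap (MulAut.conj (hz ^ (-e)) : HP →* HP) := by
      conv_lhs => rw [UH]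
      rw [Subgroup.closure_le]
      rintro _ ⟨k, rfl⟩
      show MulAut.conj (hz ^ (-e)) (cj hx hz k) ∈ UH
      rw [MulAut.conj_apply, _root_.zpow_neg, inv_inv, ← _root_.zpow_neg, cj_conj]
      exact Subgroup.subset_closure ⟨_, rfl⟩
    have := hle hg
    rw [Subgroup.mem_comap] at this
    have h2 : MulAut.conj (hz ^ (-e)) g ∈ UH := this
    rwa [MulAut.conj_apply, _root_.zpow_neg, inv_inv, ← _root_.zpow_neg] at h2
  rintro _ (rfl | rfl)
  · exact Subgroup.le_normalizer (Subgroup.subset_closure ⟨0, cj_zero⟩)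
  · rw [SetLike.mem_coe, Subgroup.mem_normalizer_iff]
    intro g
    constructor
    · intro hg; simpa using hcz (-1) g hg
    · intro hg
      have := hcz 1 _ hg
      simp only [_root_.zpow_neg_one, zpow_one] at this
      rwa [show hz⁻¹ * (hz * g * hz⁻¹) * hz = g by group] at this

/-- tau -/
def gt : GG := gz * gx

lemma Ftau : Fm (rho gt) 5 4 0 0 := by
  rw [gt, map_mul, rho_x, rho_z]
  have h2 := two0
  refine (Fz.mul Fx).congr rfl rfl ?_ ?_
  · simp only [sub_self, T_zero]; grind
  · simp only [sub_self, T_zero, bar_one]; grind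

lemma P_decomp (p : HP) : ∃ j : ℤ, ∃ g ∈ UH, (p : GG) = gt ^ j * g := by
  have htop : Subgroup.zpowers (hz * hx) ⊔ UH = ⊤ := by
    rw [eq_top_iff, ← hgen, Subgroup.closure_le]
    have hxm : hx ∈ UH := Subgroup.subset_closure ⟨0, cj_zero⟩
    rintro _ (rfl | rfl)
    · exact Subgroup.mem_sup_right hxm
    · have := mul_mem (Subgroup.mem_sup_left (T := UH) (Subgroup.mem_zpowers (hz * hx))) (Subgroup.mem_sup_right (S := Subgroup.zpowers (hz * hx)) (inv_mem hxm))
      rwa [mul_inv_cancel_right] at this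
  have hp : p ∈ Subgroup.zpowers (hz * hx) ⊔ UH := by rw [htop]; trivial
  obtain ⟨a, ⟨j, rfl⟩, g, hg, rfl⟩ := Subgroup.mem_sup_of_normal_right.1 hp
  exact ⟨j, g, hg, rfl⟩

lemma one_add_T_ne : (1 + T 1 : R2) ≠ 0 := by
  intro h
  have h' := congrArg (fun f : R2 => f.coeff 0) h
  simp only [AddMonoidAlgebra.coeff_add, Finsupp.add_apply, ← T_zero (R := ZMod 2), T_apply] at h'
  simp at h'

lemma bar_eq_zero {f : R2} (h : bar f = 0) : f = 0 := by
  rw [← bar_bar f, h, bar_zero]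

lemma Fm_u0 {g : GL3} {i j : ℤ} {u : R2} (h : Fm g i j u 0) : u = 0 := by
  have := h.2
  rw [bar_zero, mul_zero, add_zero] at this
  rcases mul_eq_zero.1 this.symm with h | h
  · exact absurd h one_add_T_ne
  · rcases mul_eq_zero.1 h with h | h
    · exact h
    · exact bar_eq_zero h

lemma lemN {p : GG} (hp : p ∈ PP) (h0 : rm p 0 2 = 0) : ∃ j l : ℤ, p = gt ^ j * gx ^ (4 * l) := by
  obtain ⟨j, g, hg, e⟩ := P_decomp ⟨p, hp⟩
  obtain ⟨θ, t0, ht⟩ := exists_th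
  obtain ⟨k, u, w, h', -⟩ := ht g hg
  have e' : p = gt ^ j * g := e
  have hF := (Ftau.zpowd j).mul h'
  rw [← map_zpow, ← map_mul, ← e'] at hF
  have hw : w = 0 := by
    have h1 := h0
    rw [rm, hF.1] at h1
    simpa [mf, (isUnit_T _).ne_zero] using h1
  subst hw
  have hu := Fm_u0 h'
  subst hu
  obtain ⟨l, hl⟩ := UH_zero hg h'
  exact ⟨j, l, by rw [e', hl]⟩

lemma F4 (l : ℤ) : Fm (rho (gx ^ (4 * l))) (4 * l) (4 * l) 0 0 := by
  have h := Fc.zpow0 (2 * l)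
  rw [← map_zpow, ← zpow_natCast, ← _root_.zpow_mul] at h
  have e : ((2 : ℕ) : ℤ) * (2 * l) = 4 * l := by push_cast; ring
  rw [e] at h
  refine h.congr (by ring) (by ring) rfl ?_
  push_cast
  rw [two0]; ring

lemma lemN1 {p : GG} (hp : p ∈ PP) (h0 : rm p = 1) : p = 1 := by
  obtain ⟨j, l, rfl⟩ := lemN hp (by rw [h0]; rfl)
  have hF := (Ftau.zpowd j).mul (F4 l)
  rw [← map_zpow, ← map_mul] at hF
  have h1 : mf _ _ _ _ = mf 0 0 0 0 := hF.1.symm.trans (h0.trans mf_one.symm)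
  obtain ⟨h1, h2, -⟩ := mf_inj h1
  have hj : j = 0 := by omega
  have hl : l = 0 := by omega
  subst hj hl
  simp

lemma gxP : gx ∈ PP := hx.2
lemma gzP : gz ∈ PP := hz.2
lemma gtP : gt ∈ PP := mul_mem gzP gxP

lemma lemN2 {p : GG} (hp : p ∈ PP) (h0 : rm p 0 2 = 0) : gy⁻¹ * p * gy ∈ PP := by
  obtain ⟨j, l, rfl⟩ := lemN hp h0
  have e1 : gy⁻¹ * gt * gy = gx * gz := by rw [gt, gz]; group
  have e2 : gy⁻¹ * gx ^ 4 * gy = gx ^ 4 := by rw [g43]; group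
  have e3 : gy⁻¹ * (gt ^ j * gx ^ (4 * l)) * gy = (gy⁻¹ * gt * gy) ^ j * (gy⁻¹ * gx ^ 4 * gy) ^ l := by
    have c : ∀ g : GG, gy⁻¹ * g * gy = MulAut.conj gy⁻¹ g := fun g => by simp
    rw [c, c, c, map_mul, map_zpow, _root_.zpow_mul, map_zpow]; rfl
  rw [e3, e1, e2]
  exact mul_mem (zpow_mem (mul_mem gxP gzP) _) (zpow_mem (pow_mem gxP _) _)

lemma real1 (u : R2) : ∃ p ∈ PP, ∃ k w, Fm (rho p) k k u w := by
  let S : AddSubgroup R2 :=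
    { carrier := {u | ∃ p ∈ PP, ∃ k w, Fm (rho p) k k u w}
      zero_mem' := ⟨1, one_mem _, 0, 0, by rw [map_one]; exact Fm.one⟩
      add_mem' := by
        rintro a b ⟨p, hp, k, w, h⟩ ⟨p', hp', k', w', h'⟩
        exact ⟨p * p', mul_mem hp hp', _, _, by rw [map_mul]; exact h.mul' h'⟩
      neg_mem' := by
        rintro a h
        rw [CharTwo.neg_eq]; exact h }
  show u ∈ S
  rw [eq_sum_T u]
  refine sum_mem fun i _ => ?_
  obtain ⟨w, h⟩ := Fcj i
  exact ⟨_, (cj hx hz i).2, 1, w, h⟩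

lemma real2 (f : R2) : ∃ p ∈ PP, ∃ k, Fm (rho p) k k 0 (f + T 1 * bar f) := by
  let S : AddSubgroup R2 :=
    { carrier := {f | ∃ p ∈ PP, ∃ k, Fm (rho p) k k 0 (f + T 1 * bar f)}
      zero_mem' := ⟨1, one_mem _, 0, by rw [map_one]; simpa using Fm.one⟩
      add_mem' := by
        rintro a b ⟨p, hp, k, h⟩ ⟨p', hp', k', h'⟩
        refine ⟨p * p', mul_mem hp hp', _, by
          rw [map_mul]
          refine (h.mul' h').congr rfl rfl (by ring) ?_
          rw [bar_zero, bar_add]; ring⟩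
      neg_mem' := by
        rintro a h
        rw [CharTwo.neg_eq]; exact h }
  have hn : ∀ n : ℕ, ∃ p ∈ PP, ∃ k, Fm (rho p) k k 0 (T (-n) + T (n + 1)) := by
    intro n
    induction n with
    | zero => exact ⟨gx ^ 2, pow_mem gxP 2, 2, by simpa [T_zero] using Fc⟩
    | succ n ih =>
      obtain ⟨p, hp, k, h⟩ := ih
      refine ⟨p * dd gx gz (n + 1 : ℕ), mul_mem hp (dd hx hz (n + 1 : ℕ)).2, k, ?_⟩
      rw [map_mul]
      refine (h.mul' (Fdd _)).congr (by ring) (by ring) (by ring) ?_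
      rw [vv, bar_zero]
      push_cast
      rw [show (1 - (n + 1 : ℤ)) = -n by ring]
      have h2 := two0
      grind
  show f ∈ S
  rw [eq_sum_T f]
  refine sum_mem fun i _ => ?_
  show ∃ p ∈ PP, ∃ k, Fm (rho p) k k 0 (T i + T 1 * bar (T i))
  rw [bar_T, ← T_add]
  rcases le_or_gt i 0 with hi | hi
  · obtain ⟨p, hp, k, h⟩ := hn (-i).toNat
    rw [Int.toNat_of_nonneg (by omega)] at h
    exact ⟨p, hp, k, h.congr rfl rfl rfl (by rw [neg_neg, add_comm (-i) 1])⟩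
  · obtain ⟨p, hp, k, h⟩ := hn (i - 1).toNat
    rw [Int.toNat_of_nonneg (by omega)] at h
    exact ⟨p, hp, k, h.congr rfl rfl rfl (by rw [add_comm, sub_add_cancel, neg_sub, sub_eq_add_neg])⟩

abbrev V3 := Fin 3 → R2

/-- action on lattices -/
def act (g : GG) (L : AddSubgroup V3) : AddSubgroup V3 :=
  L.comap (Matrix.mulVecLin (rm g⁻¹)).toAddMonoidHom

/-- scaling -/
def sc (k : ℤ) (L : AddSubgroup V3) : AddSubgroup V3 :=
  L.comap (DistribMulAction.toAddMonoidHom V3 (T (-k) : R2))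

lemma mem_act {g : GG} {L : AddSubgroup V3} {v : V3} : v ∈ act g L ↔ rm g⁻¹ *ᵥ v ∈ L := Iff.rfl
lemma mem_sc {k : ℤ} {L : AddSubgroup V3} {v : V3} : v ∈ sc k L ↔ (T (-k) : R2) • v ∈ L := Iff.rfl

lemma act_mul (g h : GG) (L : AddSubgroup V3) : act (g * h) L = act g (act h L) := by
  ext v
  rw [mem_act, mem_act, mem_act, _root_.mul_inv_rev, rm_mul, Matrix.mulVec_mulVec]

lemma act_one (L : AddSubgroup V3) : act 1 L = L := by
  ext v; rw [mem_act, inv_one, rm_one, Matrix.one_mulVec]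

lemma act_inv_act (g : GG) (L : AddSubgroup V3) : act g⁻¹ (act g L) = L := by
  rw [← act_mul, inv_mul_cancel, act_one]

lemma act_act_inv (g : GG) (L : AddSubgroup V3) : act g (act g⁻¹ L) = L := by
  rw [← act_mul, mul_inv_cancel, act_one]

lemma act_mono {g : GG} {L M : AddSubgroup V3} (h : L ≤ M) : act g L ≤ act g M := fun v hv => h hv

lemma mul_mem_act {g : GG} {L : AddSubgroup V3} {v : V3} : rm g *ᵥ v ∈ act g L ↔ v ∈ L := by
  rw [mem_act, Matrix.mulVec_mulVec, rm_inv_mul, Matrix.one_mulVec]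

lemma sc_sc (k l : ℤ) (L : AddSubgroup V3) : sc k (sc l L) = sc (k + l) L := by
  ext v
  rw [mem_sc, mem_sc, mem_sc, smul_smul, ← T_add]
  rw [show -l + -k = -(k + l) by ring]

lemma sc_zero (L : AddSubgroup V3) : sc 0 L = L := by
  ext v; rw [mem_sc, neg_zero, T_zero, one_smul]

lemma sc_act (k : ℤ) (g : GG) (L : AddSubgroup V3) : sc k (act g L) = act g (sc k L) := by
  ext v
  rw [mem_sc, mem_act, mem_act, mem_sc, Matrix.mulVec_smul]

lemma sc_mono {k : ℤ} {L M : AddSubgroup V3} (h : L ≤ M) : sc k L ≤ sc k M := fun v hv => h hv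

lemma smul_mem_sc {k : ℤ} {L : AddSubgroup V3} {v : V3} : (T k : R2) • v ∈ sc k L ↔ v ∈ L := by
  rw [mem_sc, smul_smul, ← T_add, neg_add_cancel, T_zero, one_smul]

/-- bounded coordinates -/
def gev (k : ℤ) (v : V3) : Prop := ∀ i, ge k (v i)

/-- lattices -/
structure IsLat (L : AddSubgroup V3) : Prop where
  t : ∀ v ∈ L, (T 1 : R2) • v ∈ L
  lo : ∃ N : ℕ, ∀ v, gev N v → v ∈ L
  hi : ∃ N : ℕ, ∀ v ∈ L, gev (-(N : ℤ)) v

lemma IsLat.sc {L : AddSubgroup V3} (h : IsLat L) (k : ℤ) : IsLat (sc k L) := by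
  refine ⟨fun v hv => ?_, ?_, ?_⟩
  · rw [mem_sc] at *
    rw [smul_comm]; exact h.t _ hv
  · obtain ⟨N, hN⟩ := h.lo
    refine ⟨N + k.natAbs, fun v hv => ?_⟩
    rw [mem_sc]
    refine hN _ fun i => ?_
    rw [Pi.smul_apply, smul_eq_mul, ge_T_mul]
    exact ge_mono (by rw [Nat.cast_add]; omega) (hv i)
  · obtain ⟨N, hN⟩ := h.hi
    refine ⟨N + k.natAbs, fun v hv i => ?_⟩
    rw [mem_sc] at hv
    have := hN _ hv i
    rw [Pi.smul_apply, smul_eq_mul, ge_T_mul] at this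
    exact ge_mono (by rw [Nat.cast_add]; omega) this

lemma mulVec_ge (A : M3) : ∃ N : ℕ, ∀ k v, gev k v → gev (k - N) (A *ᵥ v) := by
  have h : ∀ i j, ∃ N : ℕ, ge (-(N : ℤ)) (A i j) := fun i j => exists_ge _
  choose n hn using h
  refine ⟨∑ i, ∑ j, n i j, fun k v hv i => ?_⟩
  have h1 : ∀ j, ge (k - (∑ i, ∑ j, n i j : ℕ)) (A i j * v j) := by
    intro j
    have e1 : n i j ≤ ∑ j, n i j := Finset.single_le_sum (f := fun j => n i j) (fun _ _ => Nat.zero_le _) (Finset.mem_univ j)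
    have e2 : ∑ j, n i j ≤ ∑ i, ∑ j, n i j := Finset.single_le_sum (f := fun i => ∑ j, n i j) (fun _ _ => Nat.zero_le _) (Finset.mem_univ i)
    refine ge_mono ?_ (ge_mul (hn i j) (hv j))
    omega
  have : (A *ᵥ v) i = A i 0 * v 0 + A i 1 * v 1 + A i 2 * v 2 := by
    simp [Matrix.mulVec, dotProduct, Fin.sum_univ_three]
  rw [this]
  exact ge_add (ge_add (h1 0) (h1 1)) (h1 2)

lemma IsLat.act {L : AddSubgroup V3} (h : IsLat L) (g : GG) : IsLat (act g L) := by
  refine ⟨fun v hv => ?_, ?_, ?_⟩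
  · rw [mem_act] at *
    rw [Matrix.mulVec_smul]; exact h.t _ hv
  · obtain ⟨N, hN⟩ := h.lo
    obtain ⟨K, hK⟩ := mulVec_ge (rm g⁻¹)
    refine ⟨N + K, fun v hv => ?_⟩
    rw [mem_act]
    refine hN _ ?_
    have := hK _ _ hv
    push_cast at this
    rwa [add_sub_cancel_right] at this
  · obtain ⟨N, hN⟩ := h.hi
    obtain ⟨K, hK⟩ := mulVec_ge (rm g)
    refine ⟨N + K, fun v hv => ?_⟩
    rw [mem_act] at hv
    have := hK _ _ (hN _ hv)
    rw [Matrix.mulVec_mulVec, rm_mul_inv, Matrix.one_mulVec] at this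
    push_cast
    rwa [neg_add, ← sub_eq_add_neg]

/-- standard lattice -/
def L0 : AddSubgroup V3 where
  carrier := {v | gev 0 v}
  zero_mem' := fun i => ge_zero 0
  add_mem' := fun ha hb i => ge_add (ha i) (hb i)
  neg_mem' := fun {a} ha i => by
    rw [Pi.neg_apply, CharTwo.neg_eq]; exact ha i

lemma L0_lat : IsLat L0 := by
  refine ⟨fun v hv i => ?_, ⟨0, fun v hv => hv⟩, ⟨0, fun v hv => by rw [Nat.cast_zero, neg_zero]; exact hv⟩⟩
  rw [Pi.smul_apply, smul_eq_mul, ge_T_mul]; exact ge_mono (by omega) (hv i)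

/-- f1 scaled -/
abbrev f1 (f : R2) : V3 := ![f, 0, 0]

/-- base condition -/
def B0 (L : AddSubgroup V3) : Prop := ∃ k : ℤ, f1 (T k) ∈ L ∧ ∀ v ∈ L, ge k (v 2)

lemma smul3 (a b c d : R2) : a • (![b, c, d] : V3) = ![a * b, a * c, a * d] := by
  ext1 i; fin_cases i <;> rfl

lemma add3 (a b c a' b' c' : R2) : (![a, b, c] : V3) + ![a', b', c'] = ![a + a', b + b', c + c'] := by
  ext1 i; fin_cases i <;> rfl

lemma eta3 (v : V3) : v = ![v 0, v 1, v 2] := by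
  ext1 i; fin_cases i <;> rfl

lemma mv3 (a b c d e f g h i x y z : R2) : !![a, b, c; d, e, f; g, h, i] *ᵥ ![x, y, z] =
    ![a * x + b * y + c * z, d * x + e * y + f * z, g * x + h * y + i * z] := by
  ext1 r; fin_cases r <;> simp [Matrix.mulVec, dotProduct, Fin.sum_univ_three]

lemma mv_apply (A : M3) (v : V3) (r : Fin 3) : (A *ᵥ v) r = A r 0 * v 0 + A r 1 * v 1 + A r 2 * v 2 := by
  simp [Matrix.mulVec, dotProduct, Fin.sum_univ_three]

lemma B0_sc' {L : AddSubgroup V3} (k : ℤ) (h : B0 L) : B0 (sc k L) := by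
  obtain ⟨m, h1, h2⟩ := h
  refine ⟨m + k, ?_, fun v hv => ?_⟩
  · rw [mem_sc, smul3, ← T_add, mul_zero]
    convert h1 using 3; ring
  · have := h2 _ hv
    rw [DistribMulAction.toAddMonoidHom_apply, Pi.smul_apply, smul_eq_mul, ge_T_mul] at this
    exact ge_mono (by omega) this

lemma B0_sc {L : AddSubgroup V3} (k : ℤ) : B0 (sc k L) ↔ B0 L :=
  ⟨fun h => by simpa [sc_sc, sc_zero] using B0_sc' (-k) h, B0_sc' k⟩

lemma rm_P {p : GG} (hp : p ∈ PP) : ∃ i j u w, rm p = mf i j u w := by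
  obtain ⟨i, j, u, w, h⟩ := P_form hp
  exact ⟨i, j, u, w, h.1⟩

lemma B0_act' {L : AddSubgroup V3} {p : GG} (hp : p ∈ PP) (h : B0 L) : B0 (act p L) := by
  obtain ⟨m, h1, h2⟩ := h
  obtain ⟨i, j, u, w, e⟩ := rm_P hp
  refine ⟨m + i, ?_, fun v hv => ?_⟩
  · have := (mul_mem_act (g := p)).2 h1
    rw [e, mf, mv3] at this
    simp only [mul_zero, zero_mul, add_zero, ← T_add] at this
    rwa [add_comm]
  · have h3 := h2 _ hv
    have h4 : v = rm p *ᵥ (rm p⁻¹ *ᵥ v) := by rw [Matrix.mulVec_mulVec, rm_mul_inv, Matrix.one_mulVec]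
    rw [h4, mv_apply, e]
    have h3' : ge m ((rm p⁻¹ *ᵥ v) 2) := h3
    have e0 : mf i j u w 2 0 = 0 := rfl
    have e1 : mf i j u w 2 1 = 0 := rfl
    have e2 : mf i j u w 2 2 = T i := rfl
    rw [e0, e1, e2, zero_mul, zero_mul, zero_add, zero_add, ge_T_mul]
    exact ge_mono (by omega) h3'

lemma B0_act {L : AddSubgroup V3} {p : GG} (hp : p ∈ PP) : B0 (act p L) ↔ B0 L :=
  ⟨fun h => by simpa [act_inv_act] using B0_act' (inv_mem hp) h, B0_act' hp⟩

/-- ovr -/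
def ovr (g : GG) (L : AddSubgroup V3) : Prop := B0 (act g⁻¹ L)

lemma ovr_sc {g : GG} {L : AddSubgroup V3} (k : ℤ) : ovr g (sc k L) ↔ ovr g L := by
  rw [ovr, ← sc_act, B0_sc, ovr]

lemma ovr_mul {g h : GG} {L : AddSubgroup V3} : ovr (g * h) (act g L) ↔ ovr h L := by
  rw [ovr, ovr, _root_.mul_inv_rev, act_mul, act_inv_act]

lemma ovr_mulP {g p : GG} (hp : p ∈ PP) {L : AddSubgroup V3} : ovr (g * p) L ↔ ovr g L := by
  rw [ovr, ovr, _root_.mul_inv_rev, act_mul, B0_act (inv_mem hp)]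

lemma ovr_one {L : AddSubgroup V3} : ovr 1 L ↔ B0 L := by rw [ovr, inv_one, act_one]

lemma mv_f1 (A : M3) (f : R2) (r : Fin 3) : (A *ᵥ f1 f) r = A r 0 * f := by
  rw [mv_apply]; simp

lemma lemA {g : GG} {L : AddSubgroup V3} (h1 : B0 L) (h2 : B0 (act g L)) : rm g 2 0 = 0 := by
  obtain ⟨k, a1, a2⟩ := h1
  obtain ⟨k', b1, b2⟩ := h2
  have e1 := a2 _ b1
  have e2 := b2 _ ((mul_mem_act (g := g)).2 a1)
  have e1' : ge k ((rm g⁻¹ *ᵥ f1 (T k')) 2) := e1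
  rw [mv_f1, mul_comm, ge_T_mul] at e1' e2
  refine ge_bar_contra (k := k' - k) (l := k - k' + 1) e2 ?_ (by omega)
  rw [← inv31, ge_T_mul]
  exact ge_mono (by omega) e1'

/-- adjacency of cosets -/
def EE (g h : GG) : Prop := g⁻¹ * h ∈ PP ∨ ∃ a ∈ PP, ∃ b ∈ PP, g⁻¹ * h = a * gy * b

lemma EE_left (k g h : GG) : EE (k * g) (k * h) ↔ EE g h := by
  have : (k * g)⁻¹ * (k * h) = g⁻¹ * h := by group
  rw [EE, EE, this]

lemma EE_rightP {g h p : GG} (hp : p ∈ PP) (H : EE g h) : EE g (h * p) := by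
  rcases H with H | ⟨a, ha, b, hb, e⟩
  · left; rw [← mul_assoc]; exact mul_mem H hp
  · right; exact ⟨a, ha, b * p, mul_mem hb hp, by rw [← mul_assoc, e]; group⟩

lemma gy_inv : gy⁻¹ = gx * gy * gz⁻¹ := by rw [gz]; group

lemma EE_symm {g h : GG} (H : EE g h) : EE h g := by
  have e0 : h⁻¹ * g = (g⁻¹ * h)⁻¹ := by group
  rcases H with H | ⟨a, ha, b, hb, e⟩
  · left; rw [e0]; exact inv_mem H
  · right
    refine ⟨b⁻¹ * gx, mul_mem (inv_mem hb) gxP, gz⁻¹ * a⁻¹, mul_mem (inv_mem gzP) (inv_mem ha), ?_⟩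
    rw [e0, e, _root_.mul_inv_rev, _root_.mul_inv_rev, gy_inv]; group

lemma EE_leftP {g h p : GG} (hp : p ∈ PP) (H : EE g h) : EE (g * p) h := EE_symm (EE_rightP hp (EE_symm H))

lemma EE_of_mem {g h : GG} (H : g⁻¹ * h ∈ PP) : EE g h := Or.inl H

lemma EE_self (g : GG) : EE g g := Or.inl (by rw [inv_mul_cancel]; exact one_mem _)

lemma EE_y {p q : GG} (hp : p ∈ PP) (hq : q ∈ PP) : EE 1 (p * gy * q) := Or.inr ⟨p, hp, q, hq, by group⟩

lemma EE_congr_right {g h h' : GG} (hh : h⁻¹ * h' ∈ PP) (H : EE g h) : EE g h' := by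
  have := EE_rightP hh H
  rwa [mul_inv_cancel_left] at this

lemma EE_congr_left {g g' h : GG} (hh : g⁻¹ * g' ∈ PP) (H : EE g h) : EE g' h :=
  EE_symm (EE_congr_right hh (EE_symm H))

lemma e31 {p q g : GG} (hp : p ∈ PP) (hq : q ∈ PP) (h : rm (p * g * q) 2 0 = 0) : rm g 2 0 = 0 := by
  obtain ⟨i, j, u, w, e⟩ := rm_P hp
  obtain ⟨i', j', u', w', e'⟩ := rm_P hq
  have : rm (p * g * q) 2 0 = T i * rm g 2 0 * T i' := by
    rw [rm_mul, rm_mul, e, e']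
    have e0 : mf i j u w 2 0 = 0 := rfl
    have e1 : mf i j u w 2 1 = 0 := rfl
    have e2 : mf i j u w 2 2 = T i := rfl
    have e3 : mf i' j' u' w' 0 0 = T i' := rfl
    have e4 : mf i' j' u' w' 1 0 = 0 := rfl
    have e5 : mf i' j' u' w' 2 0 = 0 := rfl
    simp only [Matrix.mul_apply, Fin.sum_univ_three, e0, e1, e2, e3, e4, e5]
    ring
  rw [this] at h
  simpa [(isUnit_T _).ne_zero] using h

lemma rm_y : rm gy = !![0, 0, T 2; 0, T 1, T 1; T 1, T 1 * (1 + T 1), T 1] := by rw [rm, rho_y, ytm]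
lemma rm_yi : rm gy⁻¹ = !![T (-1), T (-1) + 1, T (-1); T (-2), T (-1), 0; T (-2), 0, 0] := by
  rw [rm, map_inv, rho_y, yti]
lemma rm_x : rm gx = !![T 1, T 1 * (1 + T 1), T 1 * T 1; 0, T 1, T 1; 0, 0, T 1] := by rw [rm, rho_x, xtm]
lemma rm_xi : rm gx⁻¹ = !![T (-1), T (-1) * (1 + T 1), T (-1); 0, T (-1), T (-1); 0, 0, T (-1)] := by
  rw [rm, map_inv, rho_x, xti]

lemma T_ne (n : ℤ) : (T n : R2) ≠ 0 := (isUnit_T n).ne_zero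

lemma y31 : rm gy 2 0 ≠ 0 := by rw [rm_y]; exact T_ne 1

lemma P_of_yy {p : GG} (hp : p ∈ PP) (h : rm (gy⁻¹ * p * gy) 2 0 = 0) : gy⁻¹ * p * gy ∈ PP := by
  apply lemN2 hp
  have a0 : rm gy⁻¹ 2 0 = T (-2) := by rw [rm_yi]; rfl
  have a1 : rm gy⁻¹ 2 1 = 0 := by rw [rm_yi]; rfl
  have a2 : rm gy⁻¹ 2 2 = 0 := by rw [rm_yi]; rfl
  have a3 : rm gy 0 0 = 0 := by rw [rm_y]; rfl
  have a4 : rm gy 1 0 = 0 := by rw [rm_y]; rfl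
  have a5 : rm gy 2 0 = T 1 := by rw [rm_y]; rfl
  rw [rm_mul, rm_mul] at h
  simp only [Matrix.mul_apply, Fin.sum_univ_three, a0, a1, a2, a3, a4, a5] at h
  simpa [(isUnit_T _).ne_zero] using h

lemma lemU {g h h' : GG} {M : AddSubgroup V3} (o : ovr h M) (o' : ovr h' M) (E : EE g h) (E' : EE g h') :
    h⁻¹ * h' ∈ PP := by
  have e0 : act h'⁻¹ M = act (h'⁻¹ * h) (act h⁻¹ M) := by rw [← act_mul]; congr 1; group
  rw [ovr] at o o'
  rw [e0] at o'
  have hA := lemA o o'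
  have e1 : h'⁻¹ * h = (g⁻¹ * h')⁻¹ * (g⁻¹ * h) := by group
  have e2 : h⁻¹ * h' = (g⁻¹ * h)⁻¹ * (g⁻¹ * h') := by group
  rcases E with E | ⟨a, ha, b, hb, e⟩ <;> rcases E' with E' | ⟨a', ha', b', hb', e'⟩
  · rw [e2]; exact mul_mem (inv_mem E) E'
  · exfalso
    have h3 : rm (h⁻¹ * h') 2 0 = 0 := by
      have := inv31 (h⁻¹ * h')
      rw [show (h⁻¹ * h')⁻¹ = h'⁻¹ * h by group, hA, mul_zero] at this
      exact bar_eq_zero this.symm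
    rw [e2, e', show (g⁻¹ * h)⁻¹ * (a' * gy * b') = ((g⁻¹ * h)⁻¹ * a') * gy * b' by group] at h3
    exact y31 (e31 (mul_mem (inv_mem E) ha') hb' h3)
  · exfalso
    rw [e1, e, show (g⁻¹ * h')⁻¹ * (a * gy * b) = ((g⁻¹ * h')⁻¹ * a) * gy * b by group] at hA
    exact y31 (e31 (mul_mem (inv_mem E') ha) hb hA)
  · have e3 : h'⁻¹ * h = b'⁻¹ * (gy⁻¹ * (a'⁻¹ * a) * gy) * b := by rw [e1, e, e']; group
    rw [e3] at hA
    have := P_of_yy (mul_mem (inv_mem ha') ha) (e31 (inv_mem hb') hb hA)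
    have h4 : h'⁻¹ * h ∈ PP := by rw [e3]; exact mul_mem (mul_mem (inv_mem hb') this) hb
    have := inv_mem h4
    rwa [_root_.mul_inv_rev, inv_inv] at this

/-- adjacency -/
def Adj (L M : AddSubgroup V3) : Prop := L ≤ M ∧ ∀ v ∈ M, (T 1 : R2) • v ∈ L

lemma Adj.act {L M : AddSubgroup V3} (h : Adj L M) (g : GG) : Adj (act g L) (act g M) := by
  refine ⟨act_mono h.1, fun v hv => ?_⟩
  rw [mem_act, Matrix.mulVec_smul]; exact h.2 _ hv

lemma Adj.sc {L M : AddSubgroup V3} (h : Adj L M) (k : ℤ) : Adj (sc k L) (sc k M) := by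
  refine ⟨sc_mono h.1, fun v hv => ?_⟩
  rw [mem_sc, smul_comm]; exact h.2 _ hv

lemma smul_ge {L : AddSubgroup V3} (ht : ∀ v ∈ L, (T 1 : R2) • v ∈ L) {f : R2} (hf : ge 0 f) {v : V3} (hv : v ∈ L) :
    f • v ∈ L := by
  let S : AddSubgroup R2 :=
    { carrier := {f | f • v ∈ L}
      zero_mem' := by show (0 : R2) • v ∈ L; rw [zero_smul]; exact zero_mem _
      add_mem' := fun {a b} ha hb => by
        show (a + b) • v ∈ L; rw [add_smul]; exact add_mem ha hb
      neg_mem' := fun {a} ha => by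
        show (-a) • v ∈ L; rw [neg_smul]; exact neg_mem ha }
  have : f ∈ S := by
    refine ge_ind (k := 0) ?_ hf
    intro n hn
    obtain ⟨m, rfl⟩ := Int.eq_ofNat_of_zero_le hn
    show (T (m : ℤ) : R2) • v ∈ L
    induction m with
    | zero => rw [Nat.cast_zero, T_zero, one_smul]; exact hv
    | succ m ih =>
      rw [Nat.cast_add, Nat.cast_one, add_comm, T_add, mul_smul]
      exact ht _ (ih (by omega))
  exact this

lemma v3_eq {a b c a' b' c' : R2} (h1 : a = a') (h2 : b = b') (h3 : c = c') : (![a, b, c] : V3) = ![a', b', c'] := by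
  rw [h1, h2, h3]

/-- normalized lattice data -/
structure NL (L : AddSubgroup V3) (b : ℤ) (y r s : R2) : Prop where
  t : ∀ v ∈ L, (T 1 : R2) • v ∈ L
  e1 : ![1, 0, 0] ∈ L
  e2 : ![y, T b, 0] ∈ L
  e3 : ![s, r, 1] ∈ L
  h1 : ∀ a, ![a, 0, 0] ∈ L → ge 0 a
  h2 : ∀ a c, ![a, c, 0] ∈ L → ge b c
  h3 : ∀ v ∈ L, ge 0 (v 2)

lemma NL.final {L : AddSubgroup V3} {y r s : R2} (h : NL L 0 y r s) (hy : ge 0 y) (hr : ge 0 r) (hs : ge 0 s) : L = L0 := by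
  have h2 := two0
  apply le_antisymm
  · intro v hv
    rw [eta3 v] at hv
    have a3 := h.h3 _ hv
    replace a3 : ge 0 (v 2) := a3
    have m1 := add_mem hv (smul_ge h.t a3 h.e3)
    rw [smul3, add3, show v 2 + v 2 * 1 = 0 by grind] at m1
    have a2 := h.h2 _ _ m1
    have m2 := add_mem m1 (smul_ge h.t a2 h.e2)
    rw [smul3, add3, T_zero, show v 1 + v 2 * r + (v 1 + v 2 * r) * 1 = 0 by grind, mul_zero, add_zero] at m2
    have a1 := h.h1 _ m2
    have b2 : ge 0 (v 1) := by
      have := ge_add a2 (ge_mul0 a3 hr)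
      rwa [show v 1 + v 2 * r + v 2 * r = v 1 by grind] at this
    have b1 : ge 0 (v 0) := by
      have := ge_add (ge_add a1 (ge_mul0 a3 hs)) (ge_mul0 a2 hy)
      rwa [show v 0 + v 2 * s + (v 1 + v 2 * r) * y + v 2 * s + (v 1 + v 2 * r) * y = v 0 by grind] at this
    intro i
    fin_cases i
    exacts [b1, b2, a3]
  · intro v hv
    have a1 : ge 0 (v 0) := hv 0
    have a2 : ge 0 (v 1) := hv 1
    have a3 : ge 0 (v 2) := hv 2
    have c2 : ge 0 (v 1 + v 2 * r) := ge_add a2 (ge_mul0 a3 hr)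
    have c1 : ge 0 (v 0 + v 2 * s + (v 1 + v 2 * r) * y) := ge_add (ge_add a1 (ge_mul0 a3 hs)) (ge_mul0 c2 hy)
    have := add_mem (add_mem (smul_ge h.t a3 h.e3) (smul_ge h.t c2 h.e2)) (smul_ge h.t c1 h.e1)
    rw [smul3, smul3, smul3, add3, add3] at this
    rw [eta3 v]
    rw [T_zero] at this
    rwa [v3_eq (a := v 0) (b := v 1) (c := v 2)]
    · grind
    · grind
    · grind

lemma mem_D {L : AddSubgroup V3} {p : GG} {i j : ℤ} {u w : R2} (e : rm p = mf i j u w) {v : V3} :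
    v ∈ sc (-i) (act p L) ↔ ∃ a b c, ![a, b, c] ∈ L ∧
      v = ![a + (1 + T 1) * bar u * b + w * c, T (j - i) * (b + u * c), c] := by
  have hT := TT i
  have hj : (T (j - i) : R2) * T i = T j := by rw [← T_add]; congr 1; ring
  have key : ∀ a b c : R2, rm p *ᵥ ![a, b, c] = (T i : R2) • ![a + (1 + T 1) * bar u * b + w * c, T (j - i) * (b + u * c), c] := by
    intro a b c
    rw [e, mf, mv3, smul3]
    congr 1
    · ring
    · congr 1
      · rw [← hj]; ring
      · congr 1; ring
  rw [mem_sc, neg_neg, mem_act]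
  constructor
  · intro h
    refine ⟨_, _, _, by rw [← eta3]; exact h, ?_⟩
    have k := key ((rm p⁻¹ *ᵥ ((T i : R2) • v)) 0) ((rm p⁻¹ *ᵥ ((T i : R2) • v)) 1) ((rm p⁻¹ *ᵥ ((T i : R2) • v)) 2)
    rw [← eta3, Matrix.mulVec_mulVec, rm_mul_inv, Matrix.one_mulVec] at k
    have := congrArg (fun v => (T (-i) : R2) • v) k
    simp only [smul_smul] at this
    rwa [mul_comm, hT, one_smul, one_smul] at this
  · rintro ⟨a, b, c, h, rfl⟩
    rw [← key, Matrix.mulVec_mulVec, rm_inv_mul, Matrix.one_mulVec]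
    exact h

lemma v3_inj {a b c a' b' c' : R2} (h : (![a, b, c] : V3) = ![a', b', c']) : a = a' ∧ b = b' ∧ c = c' :=
  ⟨congrFun h 0, congrFun h 1, congrFun h 2⟩

lemma NL.act {L : AddSubgroup V3} {b : ℤ} {y r s : R2} (h : NL L b y r s) {p : GG} {i j : ℤ} {u w : R2} (e : rm p = mf i j u w) :
    NL (sc (-i) (act p L)) (b + j - i) (y + (1 + T 1) * bar u * T b) (T (j - i) * (r + u)) (s + (1 + T 1) * bar u * r + w) := by
  refine ⟨fun v hv => ?_, ?_, ?_, ?_, ?_, ?_, ?_⟩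
  · rw [mem_D e] at *
    obtain ⟨a, b, c, hm, rfl⟩ := hv
    refine ⟨T 1 * a, T 1 * b, T 1 * c, ?_, ?_⟩
    · rw [← smul3]; exact h.t _ hm
    · rw [smul3]
      congr 1
      · ring
      · congr 1; ring
  · rw [mem_D e]
    exact ⟨1, 0, 0, h.e1, by simp only [mul_zero, add_zero]⟩
  · rw [mem_D e]
    refine ⟨y, T b, 0, h.e2, ?_⟩
    simp only [mul_zero, add_zero, ← T_add]
    congr 3; ring
  · rw [mem_D e]
    refine ⟨s, r, 1, h.e3, ?_⟩
    simp only [mul_one]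
  · intro a ha
    rw [mem_D e] at ha
    obtain ⟨a', b', c', hm, he⟩ := ha
    obtain ⟨q1, q2, q3⟩ := v3_inj he
    subst q3
    rw [mul_zero, add_zero] at q2 q1
    have : b' = 0 := by
      rcases mul_eq_zero.1 q2.symm with h | h
      · exact absurd h (T_ne _)
      · exact h
    subst this
    rw [mul_zero, add_zero] at q1
    rw [q1]; exact h.h1 _ hm
  · intro a c ha
    rw [mem_D e] at ha
    obtain ⟨a', b', c', hm, he⟩ := ha
    obtain ⟨q1, q2, q3⟩ := v3_inj he
    subst q3
    rw [mul_zero, add_zero] at q2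
    rw [q2, ge_T_mul]
    exact ge_mono (by omega) (h.h2 _ _ hm)
  · intro v hv
    rw [mem_D e] at hv
    obtain ⟨a', b', c', hm, rfl⟩ := hv
    have := h.h3 _ hm
    exact this

lemma geomS (N : ℕ) : ∃ S : R2, (1 + T 1) * S = 1 + T N := by
  have h2 := two0
  induction N with
  | zero => exact ⟨0, by rw [Nat.cast_zero, T_zero]; grind⟩
  | succ n ih =>
    obtain ⟨S, hS⟩ := ih
    refine ⟨S + T n, ?_⟩
    rw [Nat.cast_add, Nat.cast_one, T_add]
    grind

lemma ge_1t {k : ℤ} {f : R2} (h : ge k f) : ge k ((1 + T 1) * f) :=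
  ge_mul0 (ge_add ge_one (ge_T (by omega))) h

lemma sc_act_comp (i j : ℤ) (p q : GG) (L : AddSubgroup V3) : sc i (act p (sc j (act q L))) = sc (i + j) (act (p * q) L) := by
  rw [sc_act, sc_sc, sc_act, ← act_mul, sc_act]

lemma NL.tr3 {L : AddSubgroup V3} {y r s : R2} (h : NL L 0 y r s) (hy : ge 0 y) (hr : ge 0 r) :
    ∃ p ∈ PP, ∃ j, sc j (_root_.act p L) = L0 := by
  have h2 := two0
  obtain ⟨g, k, e, hk, hg⟩ := exists_trunc s
  obtain ⟨p, hp, n, hF⟩ := real2 g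
  have h' := h.act (p := p) hF.1
  rw [bar_zero, show (0 : ℤ) + n - n = 0 by ring, sub_self, T_zero, one_mul, mul_zero, zero_mul, zero_mul, add_zero, add_zero, add_zero] at h'
  refine ⟨p, hp, -n, h'.final hy hr ?_⟩
  rw [e, show g + k + (g + T 1 * bar g) = k + T 1 * bar g by grind]
  refine ge_add hk ?_
  rw [ge_T_mul]; exact ge_mono (by omega) hg

lemma NL.tr2 {L : AddSubgroup V3} {y r s : R2} (h : NL L 0 y r s) :
    ∃ p ∈ PP, ∃ j, sc j (_root_.act p L) = L0 := by
  have h2 := two0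
  obtain ⟨g, k, e, hk, hg⟩ := exists_trunc r
  obtain ⟨N, hN⟩ := exists_ge y
  obtain ⟨S, hS⟩ := geomS N
  obtain ⟨g', k', e', hk', hg'⟩ := exists_trunc (S * y)
  obtain ⟨p, hp, n, w, hF⟩ := real1 (g + bar g')
  have h' := h.act (p := p) hF.1
  rw [show (0 : ℤ) + n - n = 0 by ring, sub_self, T_zero, one_mul, mul_one] at h'
  obtain ⟨q, hq, j, hL⟩ := h'.tr3 (by
    rw [bar_add, bar_bar]
    have e1 : y + (1 + T 1) * (bar g + g') = T N * y + (1 + T 1) * k' + (1 + T 1) * bar g := by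
      have : (1 + T 1) * (S * y) = (1 + T N) * y := by rw [← hS]; ring
      rw [e'] at this
      grind
    rw [e1]
    refine ge_add (ge_add ?_ (ge_1t hk')) (ge_1t (ge_mono (by omega) hg))
    rw [ge_T_mul]; exact ge_mono (by omega) hN) (by
    rw [e, show g + k + (g + bar g') = k + bar g' by grind]
    exact ge_add hk (ge_mono (by omega) hg'))
  exact ⟨q * p, mul_mem hq hp, _, by rw [← hL, sc_act_comp]⟩

lemma NL.tr {L : AddSubgroup V3} {b : ℤ} {y r s : R2} (h : NL L b y r s) : ∃ p ∈ PP, ∃ j, sc j (_root_.act p L) = L0 := by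
  have e : rm (gt ^ b) = mf (b * 5) (b * 4) 0 0 := by
    rw [rm, map_zpow]; exact (Fm.zpowd Ftau b).1
  have s1 := h.act e
  rw [show b + b * 4 - b * 5 = 0 by ring] at s1
  obtain ⟨q, hq, j, hL⟩ := s1.tr2
  exact ⟨q * gt ^ b, mul_mem hq (zpow_mem gtP b), _, by rw [← hL, sc_act_comp]⟩

lemma f1_T (n : ℤ) (f : R2) : (T n : R2) • f1 f = f1 (T n * f) := by rw [smul3, mul_zero]

/-- ideal of third coordinates -/
def I3 (L : AddSubgroup V3) : AddSubgroup R2 where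
  carrier := {f | ∃ a b, ![a, b, f] ∈ L}
  zero_mem' := ⟨0, 0, by convert zero_mem L using 1; simp⟩
  add_mem' := by
    rintro f g ⟨a, b, h⟩ ⟨a', b', h'⟩
    exact ⟨_, _, by rw [← add3]; exact add_mem h h'⟩
  neg_mem' := by
    rintro f ⟨a, b, h⟩
    refine ⟨a, b, ?_⟩
    rwa [CharTwo.neg_eq]

/-- ideal of second coordinates -/
def I2 (L : AddSubgroup V3) : AddSubgroup R2 where
  carrier := {f | ∃ a, ![a, f, 0] ∈ L}
  zero_mem' := ⟨0, by convert zero_mem L using 1; simp⟩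
  add_mem' := by
    rintro f g ⟨a, h⟩ ⟨a', h'⟩
    refine ⟨a + a', ?_⟩
    have := add_mem h h'
    rwa [add3, add_zero] at this
  neg_mem' := by
    rintro f ⟨a, h⟩
    refine ⟨a, ?_⟩
    rwa [CharTwo.neg_eq]

/-- ideal of first coordinates -/
def I1 (L : AddSubgroup V3) : AddSubgroup R2 where
  carrier := {f | ![f, 0, 0] ∈ L}
  zero_mem' := by
    show ![0, 0, 0] ∈ L
    convert zero_mem L using 1; simp
  add_mem' := by
    intro f g h h'
    have := add_mem (show ![f, 0, 0] ∈ L from h) (show ![g, 0, 0] ∈ L from h')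
    rwa [add3, add_zero] at this
  neg_mem' := by
    intro f h
    show ![-f, 0, 0] ∈ L
    rwa [CharTwo.neg_eq]

lemma gev_T {N n : ℤ} (h : N ≤ n) : gev N ![T n, 0, 0] ∧ gev N ![0, T n, 0] ∧ gev N ![0, 0, T n] := by
  refine ⟨fun i => ?_, fun i => ?_, fun i => ?_⟩ <;> fin_cases i <;> first | exact ge_T h | exact ge_zero _

lemma Tr0 {L : AddSubgroup V3} (hL : IsLat L) (h1 : f1 1 ∈ L) (h2 : f1 (T (-1)) ∉ L) (h3 : ∀ v ∈ L, ge 0 (v 2))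
    (h4 : ∃ v ∈ L, (v 2).coeff 0 ≠ 0) : ∃ p ∈ PP, ∃ j, sc j (act p L) = L0 := by
  obtain ⟨N, hN⟩ := hL.lo
  obtain ⟨K, hK⟩ := hL.hi
  have t1 : ∀ f ∈ I1 L, T 1 * f ∈ I1 L := fun f hf => by
    have := hL.t _ hf
    rwa [smul3, mul_zero] at this
  have t2 : ∀ f ∈ I2 L, T 1 * f ∈ I2 L := fun f ⟨a, hf⟩ => by
    have := hL.t _ hf
    rw [smul3, mul_zero] at this
    exact ⟨_, this⟩
  have t3 : ∀ f ∈ I3 L, T 1 * f ∈ I3 L := fun f ⟨a, b, hf⟩ => by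
    have := hL.t _ hf
    rw [smul3] at this
    exact ⟨_, _, this⟩
  have n1 : ∀ n ≥ (N : ℤ), T n ∈ I1 L := fun n hn => hN _ (gev_T hn).1
  have n2 : ∀ n ≥ (N : ℤ), T n ∈ I2 L := fun n hn => ⟨0, hN _ (gev_T hn).2.1⟩
  have n3 : ∀ n ≥ (N : ℤ), T n ∈ I3 L := fun n hn => ⟨0, 0, hN _ (gev_T hn).2.2⟩
  have m3 : T 0 ∈ I3 L := by
    obtain ⟨v, hv, hc⟩ := h4
    exact approx t3 n3 (f := v 2) ⟨v 0, v 1, by rwa [← eta3]⟩ (h3 v hv) hc 0 le_rfl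
  obtain ⟨s, r, m3⟩ := m3
  rw [T_zero] at m3
  obtain ⟨b, ⟨y, hb⟩, hmin⟩ := Int.exists_least_of_bdd (P := fun b => T b ∈ I2 L) ⟨-(K : ℤ), fun z ⟨a, hz⟩ => by
    by_contra hlt
    have := hK _ hz 1 z (by omega)
    change (T z : R2).coeff z = 0 at this
    rw [T_apply, if_pos rfl] at this
    exact one_ne_zero this⟩ ⟨N, n2 N le_rfl⟩
  refine NL.tr (b := b) (y := y) (r := r) (s := s) ⟨hL.t, h1, hb, m3, ?_, ?_, h3⟩
  · intro a ha
    by_cases h0 : a = 0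
    · rw [h0]; exact ge_zero _
    obtain ⟨c, hc, hl⟩ := exists_lead h0
    have := approx t1 n1 ha hc hl
    by_cases hc0 : 0 ≤ c
    · exact ge_mono hc0 hc
    · exact absurd (this (-1) (by omega)) h2
  · intro a f ha
    by_cases h0 : f = 0
    · rw [h0]; exact ge_zero _
    obtain ⟨c, hc, hl⟩ := exists_lead h0
    exact ge_mono (hmin c (approx t2 n2 ⟨a, ha⟩ hc hl c le_rfl)) hc

lemma ge_split {k : ℤ} {f : R2} (h : ge k f) : ge (k + 1) f ∨ (f.coeff k ≠ 0 ∧ ge (k + 1) (f + T k)) := by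
  by_cases hc : f.coeff k = 0
  · left
    intro i hi
    rcases lt_or_eq_of_le (show i ≤ k by omega) with h' | rfl
    · exact h i h'
    · exact hc
  · right
    refine ⟨hc, fun i hi => ?_⟩
    rw [AddMonoidAlgebra.coeff_add, Finsupp.add_apply, T_apply]
    rcases lt_or_eq_of_le (show i ≤ k by omega) with h' | rfl
    · rw [h i h', if_neg (by omega), add_zero]
    · rw [if_pos rfl, zmod2_ne hc]; rfl

lemma Adj.mem {L M : AddSubgroup V3} (h : Adj L M) {v : V3} (hv : v ∈ L) : v ∈ M := h.1 hv

lemma nbA {L M : AddSubgroup V3} (hA : Adj L M) (hB : ¬ B0 M) (h1 : f1 1 ∈ L) (h2 : ∀ v ∈ L, ge 0 (v 2)) :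
    f1 (T (-1)) ∉ M ∧ (∃ v ∈ L, (v 2).coeff 0 ≠ 0) ∧ ∃ v ∈ M, (v 2).coeff (-1) ≠ 0 := by
  have hge : ∀ v ∈ M, ge (-1) (v 2) := fun v hv => by
    have := h2 _ (hA.2 v hv)
    rw [Pi.smul_apply, smul_eq_mul, ge_T_mul] at this
    exact this
  refine ⟨fun h => hB ⟨-1, h, hge⟩, ?_, ?_⟩
  · by_contra hc
    push Not at hc
    refine hB ⟨0, by rw [T_zero]; exact hA.1 h1, fun v hv => ?_⟩
    have h3 := hA.2 v hv
    rcases ge_split (h2 _ h3) with h4 | h4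
    · rw [Pi.smul_apply, smul_eq_mul, ge_T_mul] at h4
      exact h4
    · exact absurd (hc _ h3) h4.1
  · by_contra hc
    push Not at hc
    refine hB ⟨0, by rw [T_zero]; exact hA.1 h1, fun v hv => ?_⟩
    rcases ge_split (hge v hv) with h4 | h4
    · exact h4
    · exact absurd (hc _ hv) h4.1

lemma L0_f1 : f1 1 ∈ L0 := by
  intro i; fin_cases i
  exacts [ge_one, ge_zero _, ge_zero _]

lemma nb0 {M : AddSubgroup V3} (hA : Adj L0 M) (hB : ¬ B0 M) : f1 (T (-1)) ∉ M ∧ ∃ v ∈ M, (v 2).coeff (-1) ≠ 0 := by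
  obtain ⟨h1, _, h3⟩ := nbA hA hB L0_f1 (fun v hv => hv 2)
  exact ⟨h1, h3⟩

lemma mem_L0 {a b c : R2} (ha : ge 0 a) (hb : ge 0 b) (hc : ge 0 c) : ![a, b, c] ∈ L0 := by
  intro i; fin_cases i
  exacts [ha, hb, hc]

lemma x_L0 : sc (-1) (act gx L0) = L0 := by
  have e : rm gx = mf 1 1 1 (T 1) := by rw [rm, rho_x]; exact Fx.1
  have h2 := two0
  ext v
  rw [mem_D e, sub_self, T_zero, bar_one, mul_one]
  constructor
  · rintro ⟨a, b, c, h, rfl⟩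
    have ha : ge 0 a := h 0
    have hb : ge 0 b := h 1
    have hc : ge 0 c := h 2
    refine mem_L0 (ge_add (ge_add ha (ge_1t hb)) (ge_mul0 (ge_T (by omega)) hc)) ?_ hc
    rw [one_mul, one_mul]; exact ge_add hb hc
  · intro h
    have ha : ge 0 (v 0) := h 0
    have hb : ge 0 (v 1) := h 1
    have hc : ge 0 (v 2) := h 2
    refine ⟨v 0 + (1 + T 1) * (v 1 + v 2) + T 1 * v 2, v 1 + v 2, v 2,
      mem_L0 (ge_add (ge_add ha (ge_1t (ge_add hb hc))) (ge_mul0 (ge_T (by omega)) hc)) (ge_add hb hc) hc, ?_⟩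
    rw [eta3 v]
    apply v3_eq <;> simp <;> grind

lemma x_step {M : AddSubgroup V3} (hA : Adj L0 M) {a b : R2} (hb : ge 0 b) (h : ![T (-1) * a, T (-1) * b, T (-1)] ∈ M) :
    ![T (-1) * (a + b), T (-1) * (b + 1), T (-1)] ∈ sc (-1) (act gx M) := by
  have e : rm gx = mf 1 1 1 (T 1) := by rw [rm, rho_x]; exact Fx.1
  have h2 := two0
  have hT := TT 1
  rw [mem_D e, sub_self, T_zero, bar_one, mul_one]
  refine ⟨T (-1) * a + (b + 1), T (-1) * b, T (-1), ?_, ?_⟩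
  · have := add_mem h (hA.1 (mem_L0 (ge_add hb ge_one) (ge_zero 0) (ge_zero 0)))
    rwa [add3, add_zero, add_zero] at this
  · generalize (T 1 : R2) = t at *
    generalize (T (-1) : R2) = s at *
    apply v3_eq <;> grind

lemma x_adj {M : AddSubgroup V3} (hA : Adj L0 M) : Adj L0 (sc (-1) (act gx M)) := by
  have := (hA.act gx).sc (-1)
  rwa [x_L0] at this

/-- normal position reachable -/
def NP (M : AddSubgroup V3) : Prop :=
  ∃ p ∈ PP, ∃ j, sc j (act p L0) = L0 ∧ ![0, 0, T (-1)] ∈ sc j (act p M)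

lemma NP_step {M : AddSubgroup V3} (h : NP (sc (-1) (act gx M))) : NP M := by
  obtain ⟨p, hp, j, h1, h2⟩ := h
  refine ⟨p * gx, mul_mem hp gxP, j + -1, ?_, ?_⟩
  · rw [← sc_act_comp, x_L0, h1]
  · rw [← sc_act_comp]; exact h2

lemma NP_of {M : AddSubgroup V3} (hA : Adj L0 M) {a b : R2} (ha : a = 0 ∨ a = 1) (hb : b = 0 ∨ b = 1)
    (h : ![T (-1) * a, T (-1) * b, T (-1)] ∈ M) : NP M := by
  have h00 : ∀ M : AddSubgroup V3, Adj L0 M → ![T (-1) * 0, T (-1) * 0, T (-1)] ∈ M → NP M := fun M _ h =>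
    ⟨1, one_mem _, 0, by rw [act_one, sc_zero], by rw [act_one, sc_zero]; rwa [mul_zero] at h⟩
  have e2 : (1 + 1 : R2) = 0 := by have := two0; grind
  have h11 : ∀ M : AddSubgroup V3, Adj L0 M → ![T (-1) * 1, T (-1) * 1, T (-1)] ∈ M → NP M := fun M hA h => by
    refine NP_step (h00 _ (x_adj hA) ?_)
    have := x_step hA ge_one h
    rwa [e2] at this
  have h10 : ∀ M : AddSubgroup V3, Adj L0 M → ![T (-1) * 1, T (-1) * 0, T (-1)] ∈ M → NP M := fun M hA h => by
    refine NP_step (h11 _ (x_adj hA) ?_)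
    have := x_step hA (ge_zero _) h
    rwa [add_zero, zero_add] at this
  have h01 : ∀ M : AddSubgroup V3, Adj L0 M → ![T (-1) * 0, T (-1) * 1, T (-1)] ∈ M → NP M := fun M hA h => by
    refine NP_step (h10 _ (x_adj hA) ?_)
    have := x_step hA ge_one h
    rwa [zero_add, e2] at this
  rcases ha with rfl | rfl <;> rcases hb with rfl | rfl
  exacts [h00 M hA h, h01 M hA h, h10 M hA h, h11 M hA h]

lemma adj_ge {M : AddSubgroup V3} (hA : Adj L0 M) {v : V3} (hv : v ∈ M) (i : Fin 3) : ge (-1) (v i) := by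
  have := hA.2 v hv i
  rw [Pi.smul_apply, smul_eq_mul, ge_T_mul] at this
  exact this

lemma lead01 {f : R2} (h : ge (-1) f) : ∃ c : R2, (c = 0 ∨ c = 1) ∧ ge 0 (f + T (-1) * c) := by
  rcases ge_split h with h | h
  · exact ⟨0, Or.inl rfl, by rw [mul_zero, add_zero]; exact h⟩
  · exact ⟨1, Or.inr rfl, by rw [mul_one]; exact h.2⟩

lemma NP_all {M : AddSubgroup V3} (hA : Adj L0 M) (hB : ¬ B0 M) : NP M := by
  have h2 := two0
  obtain ⟨_, v, hv, hc⟩ := nb0 hA hB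
  obtain ⟨a, ha, ha'⟩ := lead01 (adj_ge hA hv 0)
  obtain ⟨b, hb, hb'⟩ := lead01 (adj_ge hA hv 1)
  have hc' : ge 0 (v 2 + T (-1)) := by
    rcases ge_split (adj_ge hA hv 2) with h | h
    · exact absurd (h (-1) (by omega)) hc
    · exact h.2
  refine NP_of hA ha hb ?_
  have := add_mem hv (hA.1 (mem_L0 ha' hb' hc'))
  rw [eta3 v, add3] at this
  rw [v3_eq (a' := v 0 + (v 0 + T (-1) * a)) (b' := v 1 + (v 1 + T (-1) * b)) (c' := v 2 + (v 2 + T (-1)))]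
  · exact this
  all_goals grind

lemma B0_scact {M : AddSubgroup V3} {p : GG} (hp : p ∈ PP) (j : ℤ) : B0 (sc j (act p M)) ↔ B0 M := by
  rw [B0_sc, B0_act hp]

lemma NormL {L M : AddSubgroup V3} (hL : IsLat L) (hB : B0 L) (hA : Adj L M) (hM : ¬ B0 M) :
    ∃ p ∈ PP, ∃ j, sc j (act p L) = L0 ∧ ![0, 0, T (-1)] ∈ sc j (act p M) := by
  obtain ⟨k, b1, b2⟩ := hB
  have c1 : f1 1 ∈ sc (-k) L := by
    rw [mem_sc, neg_neg, f1_T, mul_one]; exact b1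
  have c2 : ∀ v ∈ sc (-k) L, ge 0 (v 2) := fun v hv => by
    rw [mem_sc, neg_neg] at hv
    have := b2 _ hv
    rw [Pi.smul_apply, smul_eq_mul, ge_T_mul, sub_self] at this
    exact this
  have hA' := hA.sc (-k)
  have hM' : ¬ B0 (sc (-k) M) := by rwa [B0_sc]
  obtain ⟨d1, d2, d3⟩ := nbA hA' hM' c1 c2
  obtain ⟨p, hp, j, hj⟩ := Tr0 (hL.sc (-k)) c1 (fun h => d1 (hA'.1 h)) c2 d2
  have hA'' : Adj L0 (sc j (act p (sc (-k) M))) := by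
    have := (hA'.act p).sc j
    rwa [hj] at this
  obtain ⟨q, hq, i, e1, e2⟩ := NP_all hA'' (by rwa [B0_scact hp])
  have comp : ∀ K : AddSubgroup V3, sc (i + (j + -k)) (act (q * p) K) = sc i (act q (sc j (act p (sc (-k) K)))) := by
    intro K
    rw [sc_act_comp, ← sc_act (-k) (q * p), sc_sc, add_assoc]
  refine ⟨q * p, mul_mem hq hp, i + (j + -k), ?_, ?_⟩
  · rw [comp, hj, e1]
  · rw [comp]; exact e2

lemma lemM {M : AddSubgroup V3} (hA : Adj L0 M) (h3 : ![0, 0, T (-1)] ∈ M) (h1 : f1 (T (-1)) ∉ M) :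
    ovr gy M ∨ ovr (gx⁻¹ * gy) M := by
  have h2 := two0
  have hT := TT 1
  by_cases hw : ∀ w ∈ M, ge 0 (w 0)
  · left
    refine ⟨-2, ?_, fun v hv => ?_⟩
    · rw [mem_act, inv_inv, rm_y, mv3]
      simp only [mul_zero, zero_mul, add_zero, ← T_add]
      exact h3
    · rw [mem_act, inv_inv] at hv
      have e : v = rm gy⁻¹ *ᵥ (rm gy *ᵥ v) := by rw [Matrix.mulVec_mulVec, rm_inv_mul, Matrix.one_mulVec]
      have a0 : rm gy⁻¹ 2 0 = T (-2) := by rw [rm_yi]; rfl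
      have a1 : rm gy⁻¹ 2 1 = 0 := by rw [rm_yi]; rfl
      have a2 : rm gy⁻¹ 2 2 = 0 := by rw [rm_yi]; rfl
      rw [e, mv_apply, a0, a1, a2, zero_mul, zero_mul, add_zero, add_zero, ge_T_mul]
      exact hw _ hv
  · right
    push Not at hw
    have key : ∀ w ∈ M, ∃ a b : R2, (a = 0 ∨ a = 1) ∧ (b = 0 ∨ b = 1) ∧ ge 0 (w 0 + T (-1) * a) ∧ ge 0 (w 1 + T (-1) * b) ∧
        ![T (-1) * a, T (-1) * b, 0] ∈ M := by
      intro w hv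
      obtain ⟨a, ha, ha'⟩ := lead01 (adj_ge hA hv 0)
      obtain ⟨b, hb, hb'⟩ := lead01 (adj_ge hA hv 1)
      obtain ⟨c, hc, hc'⟩ := lead01 (adj_ge hA hv 2)
      refine ⟨a, b, ha, hb, ha', hb', ?_⟩
      have m3 : ![0, 0, T (-1) * c] ∈ M := by
        rcases hc with rfl | rfl
        · rw [mul_zero]; exact hA.1 (mem_L0 (ge_zero _) (ge_zero _) (ge_zero _))
        · rw [mul_one]; exact h3
      have := add_mem (add_mem hv (hA.1 (mem_L0 ha' hb' hc'))) m3
      rw [eta3 w, add3, add3] at this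
      rw [v3_eq (a' := w 0 + (w 0 + T (-1) * a) + 0) (b' := w 1 + (w 1 + T (-1) * b) + 0) (c' := w 2 + (w 2 + T (-1) * c) + T (-1) * c)]
      · exact this
      all_goals grind
    have m11 : ![T (-1), T (-1), 0] ∈ M := by
      obtain ⟨w, hv, hn⟩ := hw
      obtain ⟨a, b, ha, hb, ha', hb', hm⟩ := key w hv
      rcases ha with rfl | rfl
      · rw [mul_zero, add_zero] at ha'; exact absurd ha' hn
      rcases hb with rfl | rfl
      · rw [mul_zero, mul_one] at hm; exact absurd hm h1
      · rwa [mul_one] at hm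
    have hall : ∀ w ∈ M, ge 0 (w 0 + w 1) := by
      intro w hv
      obtain ⟨a, b, ha, hb, ha', hb', hm⟩ := key w hv
      have hs := ge_add ha' hb'
      rcases ha with rfl | rfl <;> rcases hb with rfl | rfl <;> simp only [mul_zero, mul_one, add_zero] at hs hm
      · exact hs
      · exfalso
        have := add_mem m11 hm
        rw [add3, add_zero, add_zero, show (T (-1) + T (-1) : R2) = 0 by grind] at this
        exact h1 this
      · exact absurd hm h1
      · rwa [show w 0 + T (-1) + (w 1 + T (-1)) = w 0 + w 1 by grind] at hs
    have e0 : (gx⁻¹ * gy)⁻¹ = gy⁻¹ * gx := by group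
    refine ⟨-1, ?_, fun v hv => ?_⟩
    · rw [e0, act_mul, mem_act, inv_inv, mem_act, rm_y, mv3, rm_xi]
      simp only [mul_zero, zero_mul, add_zero, ← T_add]
      rw [mv3]
      simp only [mul_zero, zero_mul, add_zero, zero_add, ← T_add]
      have := add_mem m11 h3
      rw [add3] at this
      simp only [mul_zero, zero_mul, add_zero, zero_add] at this
      simpa using this
    · rw [e0, act_mul, mem_act, inv_inv, mem_act] at hv
      set w := rm gx⁻¹ *ᵥ (rm gy *ᵥ v) with hw'
      have e : v = rm gy⁻¹ *ᵥ (rm gx *ᵥ w) := by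
        have e9 : ∀ u : V3, rm gx *ᵥ (rm gx⁻¹ *ᵥ u) = u := fun u => by
          rw [Matrix.mulVec_mulVec, rm_mul_inv, Matrix.one_mulVec]
        rw [hw', e9, Matrix.mulVec_mulVec, rm_inv_mul, Matrix.one_mulVec]
      have a0 : rm gy⁻¹ 2 0 = T (-2) := by rw [rm_yi]; rfl
      have a1 : rm gy⁻¹ 2 1 = 0 := by rw [rm_yi]; rfl
      have a2 : rm gy⁻¹ 2 2 = 0 := by rw [rm_yi]; rfl
      have b0 : rm gx 0 0 = T 1 := by rw [rm_x]; rfl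
      have b1 : rm gx 0 1 = T 1 * (1 + T 1) := by rw [rm_x]; rfl
      have b2 : rm gx 0 2 = T 1 * T 1 := by rw [rm_x]; rfl
      rw [e, mv_apply, a0, a1, a2, zero_mul, zero_mul, add_zero, add_zero, ge_T_mul, mv_apply, b0, b1, b2,
        show T 1 * w 0 + T 1 * (1 + T 1) * w 1 + T 1 * T 1 * w 2 = T 1 * ((w 0 + w 1) + T 1 * (w 1 + w 2)) by ring, ge_T_mul]
      refine ge_add (hall _ hv) ?_
      rw [ge_T_mul]
      exact ge_add (adj_ge hA hv 1) (adj_ge hA hv 2)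

lemma ovr_act {g h : GG} {L : AddSubgroup V3} : ovr (g * h) L ↔ ovr h (act g⁻¹ L) := by
  conv_lhs => rw [← act_act_inv g L]
  rw [ovr_mul]

lemma EE_xy : EE 1 (gx⁻¹ * gy) := by
  have := EE_y (inv_mem gxP) (one_mem PP)
  rwa [mul_one] at this

lemma EE_y1 : EE 1 gy := by
  have := EE_y (one_mem PP) (one_mem PP)
  rwa [mul_one, one_mul] at this

lemma EE_P {p h : GG} (hp : p ∈ PP) (H : EE 1 h) : EE 1 (p * h) := by
  have := (EE_left p 1 h).2 H
  rw [mul_one] at this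
  exact EE_congr_left (by rw [mul_one]; exact inv_mem hp) this

lemma ovr_scact {p h : GG} {j : ℤ} {M : AddSubgroup V3} (H : ovr h (sc j (act p M))) : ovr (p⁻¹ * h) M := by
  rw [ovr_sc] at H
  rwa [ovr_act, inv_inv]

lemma Ex1 {L M : AddSubgroup V3} (hL : IsLat L) (hB : B0 L) (hA : Adj L M) : ∃ h, ovr h M ∧ EE 1 h := by
  by_cases hM : B0 M
  · exact ⟨1, ovr_one.2 hM, EE_self 1⟩
  obtain ⟨p, hp, j, e1, e2⟩ := NormL hL hB hA hM
  have hA' := (hA.act p).sc j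
  rw [e1] at hA'
  rcases lemM hA' e2 (nb0 hA' (by rwa [B0_scact hp])).1 with h | h
  · exact ⟨_, ovr_scact h, EE_P (inv_mem hp) EE_y1⟩
  · exact ⟨_, ovr_scact h, EE_P (inv_mem hp) EE_xy⟩

lemma Ex {L M : AddSubgroup V3} {g : GG} (hL : IsLat L) (hg : ovr g L) (hA : Adj L M) : ∃ h, ovr h M ∧ EE g h := by
  obtain ⟨h, h1, h2⟩ := Ex1 (hL.act g⁻¹) hg (hA.act g⁻¹)
  refine ⟨g * h, ovr_act.2 h1, ?_⟩
  have := (EE_left g 1 h).2 h2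
  rwa [mul_one] at this

lemma Adj.rot {L M : AddSubgroup V3} (hA : Adj L M) : Adj M (_root_.sc (-1) L) := by
  refine ⟨fun v hv => ?_, fun v hv => ?_⟩
  · rw [mem_sc, neg_neg]; exact hA.2 v hv
  · rw [mem_sc, neg_neg] at hv; exact hA.1 hv

lemma ExD {L M : AddSubgroup V3} {g : GG} (hM : IsLat M) (hg : ovr g M) (hA : Adj L M) : ∃ h, ovr h L ∧ EE g h := by
  obtain ⟨h, h1, h2⟩ := Ex hM hg hA.rot
  exact ⟨h, (ovr_sc _).1 h1, h2⟩

lemma EE_yxy : EE gy (gx⁻¹ * gy) := by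
  right
  refine ⟨gz⁻¹ * gx ^ 5, mul_mem (inv_mem gzP) (pow_mem gxP 5), gz⁻¹, inv_mem gzP, ?_⟩
  have h1 : gy⁻¹ * (gx⁻¹ * gy) = gz⁻¹ * (gy ^ 3 * gy⁻¹) := by rw [gz]; group
  rw [h1, ← g43, gy_inv]; group

lemma F1 {L1 L2 L3 : AddSubgroup V3} (l1 : IsLat L1) (A12 : Adj L1 L2) (A13 : Adj L1 L3) (A23 : L2 ≤ L3)
    {g2 g3 : GG} (o1 : B0 L1) (o2 : ovr g2 L2) (o3 : ovr g3 L3) (E2 : EE 1 g2) (E3 : EE 1 g3) : EE g2 g3 := by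
  by_cases b2 : B0 L2
  · exact EE_congr_left (lemU (ovr_one.2 b2) o2 (EE_self 1) E2) E3
  by_cases b3 : B0 L3
  · exact EE_congr_right (lemU (ovr_one.2 b3) o3 (EE_self 1) E3) (EE_symm E2)
  obtain ⟨p, hp, j, e1, e2⟩ := NormL l1 o1 A12 b2
  have A2 := (A12.act p).sc j
  have A3 := (A13.act p).sc j
  rw [e1] at A2 A3
  have e3 : ![0, 0, T (-1)] ∈ sc j (act p L3) := sc_mono (act_mono A23) e2
  have M2 := lemM A2 e2 (nb0 A2 (by rwa [B0_scact hp])).1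
  have M3 := lemM A3 e3 (nb0 A3 (by rwa [B0_scact hp])).1
  have K2 : ∃ h, (h = gy ∨ h = gx⁻¹ * gy) ∧ (p⁻¹ * h)⁻¹ * g2 ∈ PP := by
    rcases M2 with h | h
    · exact ⟨_, Or.inl rfl, lemU (ovr_scact h) o2 (EE_P (inv_mem hp) EE_y1) E2⟩
    · exact ⟨_, Or.inr rfl, lemU (ovr_scact h) o2 (EE_P (inv_mem hp) EE_xy) E2⟩
  have K3 : ∃ h, (h = gy ∨ h = gx⁻¹ * gy) ∧ (p⁻¹ * h)⁻¹ * g3 ∈ PP := by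
    rcases M3 with h | h
    · exact ⟨_, Or.inl rfl, lemU (ovr_scact h) o3 (EE_P (inv_mem hp) EE_y1) E3⟩
    · exact ⟨_, Or.inr rfl, lemU (ovr_scact h) o3 (EE_P (inv_mem hp) EE_xy) E3⟩
  obtain ⟨h2, H2, K2⟩ := K2
  obtain ⟨h3, H3, K3⟩ := K3
  refine EE_congr_left K2 (EE_congr_right K3 ((EE_left _ _ _).2 ?_))
  rcases H2 with rfl | rfl <;> rcases H3 with rfl | rfl
  exacts [EE_self _, EE_yxy, EE_symm EE_yxy, EE_self _]

lemma F {L1 L2 L3 : AddSubgroup V3} (l1 : IsLat L1) (A12 : Adj L1 L2) (A13 : Adj L1 L3) (A23 : L2 ≤ L3)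
    {g1 g2 g3 : GG} (o1 : ovr g1 L1) (o2 : ovr g2 L2) (o3 : ovr g3 L3) (E2 : EE g1 g2) (E3 : EE g1 g3) : EE g2 g3 := by
  have := F1 (l1.act g1⁻¹) (A12.act _) (A13.act _) (act_mono A23) (g2 := g1⁻¹ * g2) (g3 := g1⁻¹ * g3) o1
    (ovr_mul.2 o2) (ovr_mul.2 o3) (by rw [← EE_left g1]; simpa using E2) (by rw [← EE_left g1]; simpa using E3)
  rwa [EE_left] at this

/-- flags -/
structure Fl (L1 L2 L3 : AddSubgroup V3) : Prop where
  l1 : IsLat L1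
  l2 : IsLat L2
  l3 : IsLat L3
  A12 : Adj L1 L2
  A13 : Adj L1 L3
  A23 : Adj L2 L3

lemma Fl.f1 {L1 L2 L3 : AddSubgroup V3} (h : Fl L1 L2 L3) {g1 g2 g3 : GG} (o1 : ovr g1 L1) (o2 : ovr g2 L2) (o3 : ovr g3 L3)
   (E2 : EE g1 g2) (E3 : EE g1 g3) : EE g2 g3 := F h.l1 h.A12 h.A13 h.A23.1 o1 o2 o3 E2 E3

lemma Fl.f2 {L1 L2 L3 : AddSubgroup V3} (h : Fl L1 L2 L3) {g1 g2 g3 : GG} (o1 : ovr g1 L1) (o2 : ovr g2 L2) (o3 : ovr g3 L3)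
   (E1 : EE g2 g1) (E3 : EE g2 g3) : EE g1 g3 :=
  EE_symm (F h.l2 h.A23 h.A12.rot h.A13.rot.1 o2 o3 ((ovr_sc _).2 o1) E3 E1)

lemma Fl.f3 {L1 L2 L3 : AddSubgroup V3} (h : Fl L1 L2 L3) {g1 g2 g3 : GG} (o1 : ovr g1 L1) (o2 : ovr g2 L2) (o3 : ovr g3 L3)
   (E1 : EE g3 g1) (E2 : EE g3 g2) : EE g1 g2 :=
  F h.l3 h.A13.rot h.A23.rot (sc_mono h.A12.1) o3 ((ovr_sc _).2 o1) ((ovr_sc _).2 o2) E1 E2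

/-- the part on the first axis -/
def kk (L : AddSubgroup V3) : AddSubgroup V3 where
  carrier := {v | v 1 = 0 ∧ v 2 = 0 ∧ (T 1 : R2) • v ∈ L}
  zero_mem' := ⟨rfl, rfl, by rw [smul_zero]; exact zero_mem _⟩
  add_mem' := fun {a b} ha hb => ⟨by rw [Pi.add_apply, ha.1, hb.1, add_zero],
    by rw [Pi.add_apply, ha.2.1, hb.2.1, add_zero], by rw [smul_add]; exact add_mem ha.2.2 hb.2.2⟩
  neg_mem' := fun {a} ha => ⟨by rw [Pi.neg_apply, ha.1, neg_zero],
    by rw [Pi.neg_apply, ha.2.1, neg_zero], by rw [smul_neg]; exact neg_mem ha.2.2⟩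

/-- combing -/
def rr (L : AddSubgroup V3) : AddSubgroup V3 := L ⊔ kk L

lemma sup_smul {A B C : AddSubgroup V3} (hA : ∀ v ∈ A, (T 1 : R2) • v ∈ C) (hB : ∀ v ∈ B, (T 1 : R2) • v ∈ C) :
    ∀ v ∈ A ⊔ B, (T 1 : R2) • v ∈ C := by
  intro v hv
  obtain ⟨a, ha, b, hb, rfl⟩ := AddSubgroup.mem_sup.1 hv
  rw [smul_add]; exact add_mem (hA a ha) (hB b hb)

lemma rr_adj {L : AddSubgroup V3} (hL : IsLat L) : Adj L (rr L) :=
  ⟨le_sup_left, sup_smul hL.t (fun v hv => hv.2.2)⟩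

lemma rr_adj_rr {L M : AddSubgroup V3} (h : Adj L M) : Adj (rr L) (rr M) := by
  refine ⟨sup_le_sup h.1 (fun v hv => ⟨hv.1, hv.2.1, h.1 hv.2.2⟩), sup_smul ?_ ?_⟩
  · intro v hv; exact (le_sup_left : L ≤ rr L) (h.2 v hv)
  · intro v hv
    refine (le_sup_right : kk L ≤ rr L) ⟨?_, ?_, h.2 _ hv.2.2⟩
    · rw [Pi.smul_apply, hv.1, smul_zero]
    · rw [Pi.smul_apply, hv.2.1, smul_zero]

lemma lat_of_adj {L M : AddSubgroup V3} (hL : IsLat L) (h : Adj L M) : IsLat M := by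
  refine ⟨fun v hv => h.1 (h.2 v hv), ?_, ?_⟩
  · obtain ⟨N, hN⟩ := hL.lo
    exact ⟨N, fun v hv => h.1 (hN v hv)⟩
  · obtain ⟨N, hN⟩ := hL.hi
    refine ⟨N + 1, fun v hv i => ?_⟩
    have := hN _ (h.2 v hv) i
    rw [Pi.smul_apply, smul_eq_mul, ge_T_mul] at this
    exact ge_mono (by rw [Nat.cast_add]; omega) this

lemma rr_lat {L : AddSubgroup V3} (hL : IsLat L) : IsLat (rr L) := lat_of_adj hL (rr_adj hL)

lemma rr_third {L : AddSubgroup V3} {k : ℤ} (h : ∀ v ∈ L, ge k (v 2)) : ∀ v ∈ rr L, ge k (v 2) := by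
  intro v hv
  obtain ⟨a, ha, b, hb, rfl⟩ := AddSubgroup.mem_sup.1 hv
  rw [Pi.add_apply, hb.2.1, add_zero]; exact h a ha

lemma B0_rr {L : AddSubgroup V3} (h : B0 L) : B0 (rr L) := by
  obtain ⟨k, h1, h2⟩ := h
  exact ⟨k, (le_sup_left : L ≤ rr L) h1, rr_third h2⟩

lemma rr_iter {k : ℤ} (n : ℕ) : ∀ (L : AddSubgroup V3), f1 (T (k + n)) ∈ L → (∀ v ∈ L, ge k (v 2)) → B0 (rr^[n] L) := by
  induction n with
  | zero =>
    intro L h1 h2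
    rw [Nat.cast_zero, add_zero] at h1
    exact ⟨k, h1, h2⟩
  | succ n ih =>
    intro L h1 h2
    rw [Function.iterate_succ_apply]
    refine ih _ ?_ (rr_third h2)
    refine (le_sup_right : kk L ≤ rr L) ⟨rfl, rfl, ?_⟩
    rw [f1_T, ← T_add]
    rw [show 1 + (k + (n : ℤ)) = k + ((n + 1 : ℕ) : ℤ) by rw [Nat.cast_add, Nat.cast_one]; ring]
    exact h1

lemma rr_B0 {L : AddSubgroup V3} (hL : IsLat L) : ∃ n, B0 (rr^[n] L) := by
  obtain ⟨N, hN⟩ := hL.lo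
  obtain ⟨K, hK⟩ := hL.hi
  refine ⟨N + K, rr_iter (k := -(K : ℤ)) _ _ ?_ (fun v hv => hK v hv 2)⟩
  refine hN _ (gev_T ?_).1
  rw [Nat.cast_add]; omega

/-- stage section -/
def SS : ℕ → AddSubgroup V3 → GG → Prop
  | 0, L, g => B0 L ∧ g ∈ PP
  | n + 1, L, g => ovr g L ∧ ∃ g', SS n (rr L) g' ∧ EE g' g

lemma ovr_P {g : GG} {L : AddSubgroup V3} (h : B0 L) (hg : g ∈ PP) : ovr g L := by
  have := (ovr_mulP (g := 1) hg).2 (ovr_one.2 h)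
  rwa [one_mul] at this

lemma EE_1P {g : GG} (hg : g ∈ PP) : EE 1 g := EE_of_mem (by rwa [inv_one, one_mul])

lemma SS_ovr {n : ℕ} {L : AddSubgroup V3} {g : GG} (h : SS n L g) : ovr g L := by
  cases n with
  | zero => exact ovr_P h.1 h.2
  | succ n => exact h.1

lemma SS_succ {n : ℕ} : ∀ {L : AddSubgroup V3} {g : GG}, SS n L g → SS (n + 1) L g := by
  induction n with
  | zero => exact fun {L g} h => ⟨ovr_P h.1 h.2, 1, ⟨B0_rr h.1, one_mem _⟩, EE_1P h.2⟩
  | succ n ih =>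
    rintro L g ⟨h1, g', h2, h3⟩
    exact ⟨h1, g', ih h2, h3⟩

lemma SS_mono {n m : ℕ} (h : n ≤ m) {L : AddSubgroup V3} {g : GG} (H : SS n L g) : SS m L g := by
  induction h with
  | refl => exact H
  | step _ ih => exact SS_succ ih

lemma SS_ex (n : ℕ) : ∀ {L : AddSubgroup V3}, IsLat L → B0 (rr^[n] L) → ∃ g, SS n L g := by
  induction n with
  | zero => exact fun {L} hL h => ⟨1, h, one_mem _⟩
  | succ n ih =>
    intro L hL h
    rw [Function.iterate_succ_apply] at h
    obtain ⟨g', hg'⟩ := ih (rr_lat hL) h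
    obtain ⟨g, h1, h2⟩ := ExD (rr_lat hL) (SS_ovr hg') (rr_adj hL)
    exact ⟨g, h1, g', hg', h2⟩

lemma inv_mul_mem {g h : GG} (H : g⁻¹ * h ∈ PP) : h⁻¹ * g ∈ PP := by
  have := inv_mem H
  rwa [_root_.mul_inv_rev, inv_inv] at this

lemma SS_uniq (n : ℕ) : ∀ {L : AddSubgroup V3} {g h : GG}, SS n L g → SS n L h → g⁻¹ * h ∈ PP := by
  induction n with
  | zero => exact fun {L g h} a b => mul_mem (inv_mem a.2) b.2
  | succ n ih =>
    rintro L g h ⟨o1, g', s1, e1⟩ ⟨o2, h', s2, e2⟩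
    exact lemU o1 o2 e1 (EE_congr_left (ih s2 s1) e2)

lemma SS_P {n : ℕ} {L : AddSubgroup V3} {g h : GG} (H : g⁻¹ * h ∈ PP) (hs : SS n L g) : SS n L h := by
  have e : h = g * (g⁻¹ * h) := by group
  cases n with
  | zero => exact ⟨hs.1, by rw [e]; exact mul_mem hs.2 H⟩
  | succ n =>
    obtain ⟨o1, g', s1, e1⟩ := hs
    exact ⟨by rw [e]; exact (ovr_mulP H).2 o1, g', s1, EE_congr_right H e1⟩

lemma SS_edge (n : ℕ) : ∀ {L M : AddSubgroup V3} {g h : GG}, IsLat L → IsLat M → Adj L M → SS n L g → SS n M h → EE g h := by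
  induction n with
  | zero => exact fun {L M g h} _ _ _ a b => EE_of_mem (mul_mem (inv_mem a.2) b.2)
  | succ n ih =>
    rintro L M g h lL lM A ⟨o1, g', s1, e1⟩ ⟨o2, h', s2, e2⟩
    have lrL := rr_lat lL
    have lrM := rr_lat lM
    have A1 := rr_adj lL
    have A2 := rr_adj lM
    have A3 := rr_adj_rr A
    have E0 := ih lrL lrM A3 s1 s2
    have hM : M ≤ M ⊔ rr L := le_sup_left
    have hR : rr L ≤ M ⊔ rr L := le_sup_right
    have hK : M ⊔ rr L ≤ rr M := sup_le A2.1 A3.1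
    have tK : ∀ v ∈ M ⊔ rr L, (T 1 : R2) • v ∈ L := sup_smul A.2 A1.2
    generalize M ⊔ rr L = K at *
    have ALK : Adj L K := ⟨A.1.trans hM, tK⟩
    have lK := lat_of_adj lL ALK
    have ARK : Adj (rr L) K := ⟨hR, fun v hv => A1.1 (tK v hv)⟩
    have AMK : Adj M K := ⟨hM, fun v hv => A.1 (tK v hv)⟩
    have AKR : Adj K (rr M) := ⟨hK, fun v hv => hM (A2.2 v hv)⟩
    have Fa : Fl L (rr L) K := ⟨lL, lrL, lK, A1, ALK, ARK⟩
    have Fb : Fl L M K := ⟨lL, lM, lK, A, ALK, AMK⟩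
    have Fc : Fl (rr L) K (rr M) := ⟨lrL, lK, lrM, ARK, A3, AKR⟩
    have Fd : Fl M K (rr M) := ⟨lM, lK, lrM, AMK, A2, AKR⟩
    have p1 := SS_ovr s1
    have p2 := SS_ovr s2
    obtain ⟨k, ok, ek⟩ := Ex lrL p1 ARK
    have c1 : EE k h' := Fc.f1 p1 ok p2 ek E0
    have c2 : EE g k := Fa.f2 o1 p1 ok e1 ek
    have c3 : EE h k := Fd.f3 o2 ok p2 e2 (EE_symm c1)
    exact Fb.f3 o1 o2 ok (EE_symm c2) (EE_symm c3)

/-- section -/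
def Sec (L : AddSubgroup V3) (g : GG) : Prop := ∃ n, SS n L g

lemma Sec_ovr {L : AddSubgroup V3} {g : GG} (h : Sec L g) : ovr g L := by
  obtain ⟨n, h⟩ := h; exact SS_ovr h

lemma Sec_ex {L : AddSubgroup V3} (hL : IsLat L) : ∃ g, Sec L g := by
  obtain ⟨n, h⟩ := rr_B0 hL
  obtain ⟨g, hg⟩ := SS_ex n hL h
  exact ⟨g, n, hg⟩

lemma Sec_uniq {L : AddSubgroup V3} {g h : GG} (a : Sec L g) (b : Sec L h) : g⁻¹ * h ∈ PP := by
  obtain ⟨n, a⟩ := a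
  obtain ⟨m, b⟩ := b
  exact SS_uniq (max n m) (SS_mono (le_max_left _ _) a) (SS_mono (le_max_right _ _) b)

lemma Sec_P {L : AddSubgroup V3} {g h : GG} (H : g⁻¹ * h ∈ PP) (a : Sec L g) : Sec L h := by
  obtain ⟨n, a⟩ := a; exact ⟨n, SS_P H a⟩

lemma Sec_edge {L M : AddSubgroup V3} {g h : GG} (hL : IsLat L) (hM : IsLat M) (A : Adj L M) (a : Sec L g) (b : Sec M h) : EE g h := by
  obtain ⟨n, a⟩ := a
  obtain ⟨m, b⟩ := b
  exact SS_edge (max n m) hL hM A (SS_mono (le_max_left _ _) a) (SS_mono (le_max_right _ _) b)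

lemma Sec_B0 {L : AddSubgroup V3} {g : GG} (h : B0 L) (hg : g ∈ PP) : Sec L g := ⟨0, h, hg⟩

/-- equivariance at a lattice -/
def Agr (c : GG) (L : AddSubgroup V3) : Prop := ∀ g, Sec L g → Sec (act c L) (c * g)

lemma Agr_aux {c : GG} {L M : AddSubgroup V3} (hL : IsLat L) (hM : IsLat M)
    (H : ∀ g h, Sec L g → Sec M h → EE g h) (H' : ∀ g h, Sec (act c L) g → Sec (act c M) h → EE g h)
    (a : Agr c L) : Agr c M := by
  intro h hh
  obtain ⟨g, hg⟩ := Sec_ex hL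
  obtain ⟨k, hk⟩ := Sec_ex (hM.act c)
  have e1 := H _ _ hg hh
  have e2 := H' _ _ (a g hg) hk
  exact Sec_P (lemU (Sec_ovr hk) (ovr_mul.2 (Sec_ovr hh)) e2 ((EE_left c g h).2 e1)) hk

lemma Agr_up {c : GG} {L M : AddSubgroup V3} (hL : IsLat L) (hM : IsLat M) (A : Adj L M) : Agr c L ↔ Agr c M :=
  ⟨Agr_aux hL hM (fun _ _ => Sec_edge hL hM A) (fun _ _ => Sec_edge (hL.act c) (hM.act c) (A.act c)),
   Agr_aux hM hL (fun _ _ a b => EE_symm (Sec_edge hL hM A b a))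
    (fun _ _ a b => EE_symm (Sec_edge (hL.act c) (hM.act c) (A.act c) b a))⟩

lemma Adj_self {L : AddSubgroup V3} (hL : IsLat L) : Adj L L := ⟨le_rfl, hL.t⟩

lemma sup_lat {L M : AddSubgroup V3} (hL : IsLat L) (hM : IsLat M) : IsLat (L ⊔ M) := by
  refine ⟨sup_smul (fun v hv => (le_sup_left : L ≤ L ⊔ M) (hL.t v hv)) (fun v hv => (le_sup_right : M ≤ L ⊔ M) (hM.t v hv)), ?_, ?_⟩
  · obtain ⟨N, hN⟩ := hL.lo
    exact ⟨N, fun v hv => (le_sup_left : L ≤ L ⊔ M) (hN v hv)⟩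
  · obtain ⟨N, hN⟩ := hL.hi
    obtain ⟨K, hK⟩ := hM.hi
    refine ⟨N + K, fun v hv i => ?_⟩
    obtain ⟨a, ha, b, hb, rfl⟩ := AddSubgroup.mem_sup.1 hv
    rw [Pi.add_apply]
    exact ge_add (ge_mono (by rw [Nat.cast_add]; omega) (hN a ha i)) (ge_mono (by rw [Nat.cast_add]; omega) (hK b hb i))

lemma mem_scL0 {k : ℤ} {v : V3} : v ∈ sc k L0 ↔ gev k v := by
  rw [mem_sc]
  constructor
  · intro h i
    have := h i
    rw [Pi.smul_apply, smul_eq_mul, ge_T_mul] at this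
    exact ge_mono (by omega) this
  · intro h i
    rw [Pi.smul_apply, smul_eq_mul, ge_T_mul]
    exact ge_mono (by omega) (h i)

lemma conn {Q : AddSubgroup V3 → Prop} (hQ : ∀ L M, IsLat L → IsLat M → Adj L M → (Q L ↔ Q M)) (h0 : Q L0)
    {L : AddSubgroup V3} (hL : IsLat L) : Q L := by
  have a : ∀ n : ℕ, Q (sc (-(n : ℤ)) L0) := by
    intro n
    induction n with
    | zero => rw [Nat.cast_zero, neg_zero, sc_zero]; exact h0
    | succ n ih =>
      have e : sc (-((n + 1 : ℕ) : ℤ)) L0 = sc (-1) (sc (-(n : ℤ)) L0) := by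
        rw [sc_sc]; congr 1; rw [Nat.cast_add, Nat.cast_one]; ring
      rw [e]
      exact (hQ _ _ (L0_lat.sc _) ((L0_lat.sc _).sc _) (Adj_self (L0_lat.sc _)).rot).1 ih
  obtain ⟨N, hN⟩ := hL.lo
  obtain ⟨K, hK⟩ := hL.hi
  have b : ∀ m : ℕ, Q (L ⊔ sc (-(K : ℤ) + m) L0) := by
    intro m
    induction m with
    | zero =>
      have : L ⊔ sc (-(K : ℤ) + (0 : ℕ)) L0 = sc (-(K : ℤ)) L0 := by
        rw [Nat.cast_zero, add_zero]
        exact sup_eq_right.2 (fun v hv => mem_scL0.2 (hK v hv))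
      rw [this]; exact a K
    | succ m ih =>
      refine (hQ _ _ (sup_lat hL (L0_lat.sc _)) (sup_lat hL (L0_lat.sc _)) ⟨?_, ?_⟩).2 ih
      · refine sup_le_sup le_rfl (fun v hv => ?_)
        rw [mem_scL0] at *
        exact fun i => ge_mono (by rw [Nat.cast_add]; omega) (hv i)
      · refine sup_smul (fun v hv => (le_sup_left : L ≤ _) (hL.t v hv)) (fun v hv => AddSubgroup.mem_sup_right ?_)
        rw [mem_scL0] at *
        intro i
        rw [Pi.smul_apply, smul_eq_mul, ge_T_mul]
        exact ge_mono (by rw [Nat.cast_add, Nat.cast_one]; omega) (hv i)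
  have c := b (K + N)
  have e : L ⊔ sc (-(K : ℤ) + (K + N : ℕ)) L0 = L := by
    apply sup_eq_left.2
    intro v hv
    rw [mem_scL0] at hv
    refine hN v (fun i => ge_mono ?_ (hv i))
    rw [Nat.cast_add]; omega
  rwa [e] at c

lemma B0_L0 : B0 L0 := ⟨0, by rw [T_zero]; exact L0_f1, fun v hv => hv 2⟩

lemma Sec_L0 {g : GG} (h : Sec L0 g) : g ∈ PP := by
  have := Sec_uniq (Sec_B0 B0_L0 (one_mem _)) h
  rwa [inv_one, one_mul] at this

lemma Agr_x : Agr gx L0 := fun g hg =>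
  Sec_B0 ((B0_act gxP).2 B0_L0) (mul_mem gxP (Sec_L0 hg))

lemma y_adj : Adj (act gy L0) (sc 1 L0) := by
  have h2 := two0
  constructor
  · intro v hv
    rw [mem_scL0]
    have e : v = rm gy *ᵥ (rm gy⁻¹ *ᵥ v) := by rw [Matrix.mulVec_mulVec, rm_mul_inv, Matrix.one_mulVec]
    rw [mem_act] at hv
    generalize rm gy⁻¹ *ᵥ v = w at *
    have c0 := hv 0
    have c1 := hv 1
    have c2 := hv 2
    rw [e, rm_y, eta3 w, mv3]
    have g1 : ∀ f, ge 0 f → ge 1 (T 1 * f) := fun f hf => by rw [ge_T_mul]; exact hf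
    intro i
    fin_cases i
    · show ge 1 (0 * w 0 + 0 * w 1 + T 2 * w 2)
      rw [zero_mul, zero_mul, zero_add, zero_add, ge_T_mul]; exact ge_mono (by omega) c2
    · show ge 1 (0 * w 0 + T 1 * w 1 + T 1 * w 2)
      rw [zero_mul, zero_add]; exact ge_add (g1 _ c1) (g1 _ c2)
    · show ge 1 (T 1 * w 0 + T 1 * (1 + T 1) * w 1 + T 1 * w 2)
      rw [mul_assoc]; exact ge_add (ge_add (g1 _ c0) (g1 _ (ge_1t c1))) (g1 _ c2)
  · intro v hv
    rw [mem_scL0] at hv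
    have c0 := hv 0
    have c1 := hv 1
    have c2 := hv 2
    rw [mem_act, Matrix.mulVec_smul, rm_yi, eta3 v, mv3, smul3]
    have g1 : ∀ n : ℤ, -2 ≤ n → ∀ f, ge 1 f → ge (-1) (T n * f) := fun n hn f hf => by
      rw [ge_T_mul]; exact ge_mono (by omega) hf
    have hz : ∀ f : R2, ge (-1) (0 * f) := fun f => by rw [zero_mul]; exact ge_zero _
    have g2 : ∀ f, ge (-1) f → ge 0 (T 1 * f) := fun f hf => by rw [ge_T_mul]; exact hf
    refine mem_L0 (g2 _ ?_) (g2 _ ?_) (g2 _ ?_)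
    · refine ge_add (ge_add (g1 _ (by omega) _ c0) ?_) (g1 _ (by omega) _ c2)
      rw [add_mul, one_mul]
      exact ge_add (g1 _ (by omega) _ c1) (ge_mono (by omega) c1)
    · exact ge_add (ge_add (g1 _ (by omega) _ c0) (g1 _ (by omega) _ c1)) (hz _)
    · exact ge_add (ge_add (g1 _ (by omega) _ c0) (hz _)) (hz _)

lemma Agr_y : Agr gy L0 := by
  intro g hg
  obtain ⟨k, hk⟩ := Sec_ex (L0_lat.act gy)
  have e := Sec_edge (L0_lat.act gy) (L0_lat.sc 1) y_adj hk (Sec_B0 ((B0_sc 1).2 B0_L0) (one_mem _))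
  have o : ovr gy (act gy L0) := by
    have := (ovr_mul (g := gy) (h := 1) (L := L0)).2 (ovr_one.2 B0_L0)
    rwa [mul_one] at this
  have u := lemU (Sec_ovr hk) o (EE_symm e) EE_y1
  refine Sec_P ?_ hk
  rw [← mul_assoc]; exact mul_mem u (Sec_L0 hg)

lemma Agr_all (c : GG) : ∀ L, IsLat L → Agr c L := by
  induction c using gen_ind with
  | hx => exact fun L hL => conn (fun L M a b A => Agr_up a b A) Agr_x hL
  | hy => exact fun L hL => conn (fun L M a b A => Agr_up a b A) Agr_y hL
  | h1 => intro L hL g hg; rwa [act_one, one_mul]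
  | hm a b iha ihb =>
    intro L hL g hg
    rw [act_mul, mul_assoc]
    exact iha _ (hL.act b) _ (ihb _ hL _ hg)
  | hi c ih =>
    intro L hL g hg
    obtain ⟨k, hk⟩ := Sec_ex (hL.act c⁻¹)
    have := ih _ (hL.act c⁻¹) _ hk
    rw [act_act_inv] at this
    have u := Sec_uniq this hg
    refine Sec_P ?_ hk
    rwa [_root_.mul_inv_rev, mul_assoc] at u

lemma rho_inj {c : GG} (h : rho c = 1) : c = 1 := by
  have e : rm c = 1 := by rw [rm, h]; rfl
  have ei : rm c⁻¹ = 1 := by rw [rm, map_inv, h, inv_one]; rfl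
  have ha : act c L0 = L0 := by
    ext v; rw [mem_act, ei, Matrix.one_mulVec]
  have := Agr_all c L0 L0_lat 1 (Sec_B0 B0_L0 (one_mem _))
  rw [ha, mul_one] at this
  exact lemN1 (Sec_L0 this) e

lemma ker_rho : (FreeGroup.lift ![xt, yt]).ker = Subgroup.normalClosure b42Rels := by
  apply le_antisymm
  · intro w hw
    rw [MonoidHom.mem_ker] at hw
    have : rho (PresentedGroup.mk b42Rels w) = 1 := by rw [← hw]; rfl
    have h := rho_inj this
    exact (QuotientGroup.eq_one_iff w).1 h
  · apply Subgroup.normalClosure_le_normal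
    intro r hr
    exact relsT r hr

/-- change of basis -/
def Bm : M3 := !![1, T 1, 1; 0, 1 + T 1, 1 + T 1; 1, 1, 1]

lemma XB : Xmat * Bm = Bm * (xt : M3) := by
  have h2 := two0
  rw [Xmat, Bm, xtm, Matrix.smul_mul, mul3, mul3]
  generalize (T 1 : R2) = t at *
  ext1 i j
  fin_cases i <;> fin_cases j <;> simp <;> grind

lemma YB : Ymat * Bm = Bm * (yt : M3) := by
  have h2 := two0
  rw [Ymat, Bm, ytm, Matrix.smul_mul, mul3, mul3, T2e]
  generalize (T 1 : R2) = t at *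
  ext1 i j
  fin_cases i <;> fin_cases j <;> simp <;> grind

/-- left multiplication is injective -/
lemma Bm_det : Bm.det ≠ 0 := by
  have h2 := two0
  have e : Bm.det = (1 + T 1) * (1 + T 1) := by
    rw [Matrix.det_fin_three]
    show (1 : R2) * (1 + T 1) * 1 - 1 * (1 + T 1) * 1 - T 1 * 0 * 1 + T 1 * (1 + T 1) * 1 + 1 * 0 * 1 - 1 * (1 + T 1) * 1 = _
    grind
  rw [e]
  exact mul_ne_zero one_add_T_ne one_add_T_ne

lemma inter (w : FreeGroup (Fin 2)) :
    ((FreeGroup.lift ![X, Y] w : GL3) : M3) * Bm = Bm * ((FreeGroup.lift ![xt, yt] w : GL3) : M3) := by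
  induction w using FreeGroup.induction_on with
  | C1 => rw [map_one, map_one, Units.val_one, one_mul, mul_one]
  | of i =>
    rw [FreeGroup.lift_apply_of, FreeGroup.lift_apply_of]
    fin_cases i
    · exact XB
    · exact YB
  | inv_of i h =>
    rw [map_inv, map_inv]
    rw [Units.inv_mul_eq_iff_eq_mul, ← mul_assoc, h, mul_assoc, Units.mul_inv, mul_one]
  | mul a b ha hb =>
    rw [map_mul, map_mul, Units.val_mul, Units.val_mul, mul_assoc, hb, ← mul_assoc, ha, mul_assoc]

lemma ker_eq : (FreeGroup.lift ![(X : GL3), Y]).ker = (FreeGroup.lift ![xt, yt]).ker := by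
  ext w
  rw [MonoidHom.mem_ker, MonoidHom.mem_ker]
  have h := inter w
  constructor
  · intro hw
    rw [hw, Units.val_one, one_mul] at h
    apply Units.ext
    have h' : Bm.adjugate * (Bm * 1) = Bm.adjugate * (Bm * ((FreeGroup.lift ![xt, yt] w : GL3) : M3)) := by rw [← h, mul_one]
    rw [← mul_assoc, ← mul_assoc, Matrix.adjugate_mul, Matrix.smul_mul, Matrix.smul_mul, one_mul, one_mul] at h'
    exact (smul_right_injective M3 Bm_det h').symm
  · intro hw
    rw [hw, Units.val_one, mul_one] at h
    apply Units.ext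
    have h' : (1 * Bm) * Bm.adjugate = (((FreeGroup.lift ![X, Y] w : GL3) : M3) * Bm) * Bm.adjugate := by rw [h, one_mul]
    rw [mul_assoc, mul_assoc, Matrix.mul_adjugate, Matrix.mul_smul, Matrix.mul_smul, mul_one, mul_one] at h'
    exact (smul_right_injective M3 Bm_det h').symm

/-- **Lemma 3.2.** `B_{4,2}` is presented by generators `x, y` with relations `x⁴ = y³`,
`[x², yxy] = 1`, and `x_i⁴ = 1`, `[x_i², yxy] = 1` for all `i ≥ 1`: the homomorphism from
the free group on `x, y` sending `x ↦ X`, `y ↦ Y` has range `B_{4,2}` and kernel the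
normal closure of the relators. -/
theorem statement8 :
    (FreeGroup.lift ![(X : GL (Fin 3) R2), Y]).range = B42 ∧
      (FreeGroup.lift ![(X : GL (Fin 3) R2), Y]).ker = Subgroup.normalClosure b42Rels := by
  refine ⟨?_, ker_eq.trans ker_rho⟩
  rw [FreeGroup.range_lift_eq_closure, B42, Matrix.range_cons_cons_empty]
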